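/- Let (A, Q) be a relative n-Auslander–Gorenstein pair (A is n-Iwanaga–Gorenstein, Ext^{i>0}_A(Q,Q)=0, and Q-domdim_A(A) ≥ n ≥ id_A(A)) with pd_A Q = l, id_A Q = m, and n ≥ m + l + 2. Let Λ = End_A(Q)^op. Then there exists an exact sequence 0 → τ⁻_{n−l−1}(Q) → Q_0 → Q_1 → ⋯ → Q_l → 0 of right Λ-modules which remains exact under Hom_Λ(−, Q), with each Q_i ∈ add(Q_Λ). -/

import Mathlib

universe u
open MulOpposite

noncomputable section
namespace Paper

section RingDefs
variable (B : Type u) [Ring B]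

/-- `X` belongs to `add Q`: it is a direct summand of a finite direct sum of copies of `Q`. -/
def InAdd (Q X : ModuleCat.{u} B) : Prop :=
  ∃ (n : ℕ) (s : X →ₗ[B] (Fin n → Q)) (r : (Fin n → Q) →ₗ[B] X), r ∘ₗ s = LinearMap.id

/-- A superfluous (small) submodule. -/
def Superfluous {P : ModuleCat.{u} B} (N : Submodule B P) : Prop :=
  ∀ K : Submodule B P, K ⊔ N = ⊤ → K = ⊤

/-- An essential (large) submodule. -/
def Essential {P : ModuleCat.{u} B} (N : Submodule B P) : Prop :=
  ∀ K : Submodule B P, K ⊓ N = ⊥ → K = ⊥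

/-- `p : P → X` is a projective cover. -/
def IsProjCover {P X : ModuleCat.{u} B} (p : P →ₗ[B] X) : Prop :=
  Module.Projective B P ∧ Function.Surjective p ∧ Superfluous B (LinearMap.ker p)

/-- `ι : X → I` is an injective envelope. -/
def IsInjEnvelope {X I : ModuleCat.{u} B} (ι : X →ₗ[B] I) : Prop :=
  Module.Injective B I ∧ Function.Injective ι ∧ Essential B (LinearMap.range ι)

/-- The zero module. -/
def zeroMod : ModuleCat.{u} B := ModuleCat.of B PUnit

/-- An exact sequence `0 → P_m → ⋯ → P_1 → P_0 → X → 0` whose terms satisfy the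
predicate `T` and which remains exact under `Hom(test, −)`. -/
def ResLE (test : ModuleCat.{u} B) (T : ModuleCat.{u} B → Prop)
    (X : ModuleCat.{u} B) (m : ℕ) : Prop :=
  ∃ (P : ℕ → ModuleCat.{u} B) (d : ∀ j, P (j+1) →ₗ[B] P j) (aug : P 0 →ₗ[B] X),
    (∀ j, j ≤ m → T (P j)) ∧ (∀ j, m < j → Subsingleton (P j)) ∧
    Function.Surjective aug ∧ Function.Exact (d 0) aug ∧
    (∀ j, Function.Exact (d (j+1)) (d j)) ∧
    (∀ f : test →ₗ[B] X, ∃ h : test →ₗ[B] P 0, aug ∘ₗ h = f) ∧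
    (∀ f : test →ₗ[B] P 0, aug ∘ₗ f = 0 → ∃ h : test →ₗ[B] P 1, d 0 ∘ₗ h = f) ∧
    (∀ j, ∀ f : test →ₗ[B] P (j+1), d j ∘ₗ f = 0 →
      ∃ h : test →ₗ[B] P (j+2), d (j+1) ∘ₗ h = f)

/-- An exact sequence `0 → X → I_0 → ⋯ → I_m → 0` whose terms satisfy the predicate `T`
and which remains exact under `Hom(−, test)`. -/
def CoresLE (test : ModuleCat.{u} B) (T : ModuleCat.{u} B → Prop)
    (X : ModuleCat.{u} B) (m : ℕ) : Prop :=
  ∃ (M : ℕ → ModuleCat.{u} B) (ι : X →ₗ[B] M 0) (d : ∀ j, M j →ₗ[B] M (j+1)),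
    (∀ j, j ≤ m → T (M j)) ∧ (∀ j, m < j → Subsingleton (M j)) ∧
    Function.Injective ι ∧ Function.Exact ι (d 0) ∧
    (∀ j, Function.Exact (d j) (d (j+1))) ∧
    (∀ f : X →ₗ[B] test, ∃ h : M 0 →ₗ[B] test, h ∘ₗ ι = f) ∧
    (∀ f : M 0 →ₗ[B] test, f ∘ₗ ι = 0 → ∃ h : M 1 →ₗ[B] test, h ∘ₗ d 0 = f) ∧
    (∀ j, ∀ f : M (j+1) →ₗ[B] test, f ∘ₗ d j = 0 →
      ∃ h : M (j+2) →ₗ[B] test, h ∘ₗ d (j+1) = f)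

/-- Projective dimension at most `n`. -/
def pdLE (X : ModuleCat.{u} B) (n : ℕ) : Prop :=
  ResLE B (zeroMod B) (fun P => Module.Projective B P) X n

/-- Injective dimension at most `n`. -/
def idLE (X : ModuleCat.{u} B) (n : ℕ) : Prop :=
  CoresLE B (zeroMod B) (fun I => Module.Injective B I) X n

/-- Projective dimension equal to `n`. -/
def pdEq (X : ModuleCat.{u} B) (n : ℕ) : Prop :=
  pdLE B X n ∧ ∀ j, pdLE B X j → n ≤ j

/-- Injective dimension equal to `n`. -/
def idEq (X : ModuleCat.{u} B) (n : ℕ) : Prop :=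
  idLE B X n ∧ ∀ j, idLE B X j → n ≤ j

/-- Projective dimension as an element of `ℕ∞`. -/
def pdDim (X : ModuleCat.{u} B) : ℕ∞ :=
  sInf {c : ℕ∞ | ∃ n : ℕ, c = n ∧ pdLE B X n}

/-- Injective dimension as an element of `ℕ∞`. -/
def idDim (X : ModuleCat.{u} B) : ℕ∞ :=
  sInf {c : ℕ∞ | ∃ n : ℕ, c = n ∧ idLE B X n}

/-- Relative dominant dimension of `X` with respect to `Q` is at least `n`:
there is an exact sequence `0 → X → Q_1 → ⋯ → Q_n` with `Q_i ∈ add Q`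
remaining exact under `Hom(−, Q)`. -/
def domdimGE (Q X : ModuleCat.{u} B) (n : ℕ) : Prop :=
  n = 0 ∨ ∃ (M : ℕ → ModuleCat.{u} B) (ι : X →ₗ[B] M 0) (d : ∀ j, M j →ₗ[B] M (j+1)),
    (∀ j, j + 1 ≤ n → InAdd B Q (M j)) ∧
    Function.Injective ι ∧ (2 ≤ n → Function.Exact ι (d 0)) ∧
    (∀ j, j + 3 ≤ n → Function.Exact (d j) (d (j+1))) ∧
    (∀ f : X →ₗ[B] Q, ∃ h : M 0 →ₗ[B] Q, h ∘ₗ ι = f) ∧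
    (2 ≤ n → ∀ f : M 0 →ₗ[B] Q, f ∘ₗ ι = 0 → ∃ h : M 1 →ₗ[B] Q, h ∘ₗ d 0 = f) ∧
    (∀ j, j + 3 ≤ n → ∀ f : M (j+1) →ₗ[B] Q, f ∘ₗ d j = 0 →
      ∃ h : M (j+2) →ₗ[B] Q, h ∘ₗ d (j+1) = f)

/-- Relative codominant dimension of `X` with respect to `Q` is at least `n`. -/
def codomdimGE (Q X : ModuleCat.{u} B) (n : ℕ) : Prop :=
  n = 0 ∨ ∃ (M : ℕ → ModuleCat.{u} B) (aug : M 0 →ₗ[B] X) (d : ∀ j, M (j+1) →ₗ[B] M j),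
    (∀ j, j + 1 ≤ n → InAdd B Q (M j)) ∧
    Function.Surjective aug ∧ (2 ≤ n → Function.Exact (d 0) aug) ∧
    (∀ j, j + 3 ≤ n → Function.Exact (d (j+1)) (d j)) ∧
    (∀ f : Q →ₗ[B] X, ∃ h : Q →ₗ[B] M 0, aug ∘ₗ h = f) ∧
    (2 ≤ n → ∀ f : Q →ₗ[B] M 0, aug ∘ₗ f = 0 → ∃ h : Q →ₗ[B] M 1, d 0 ∘ₗ h = f) ∧
    (∀ j, j + 3 ≤ n → ∀ f : Q →ₗ[B] M (j+1), d j ∘ₗ f = 0 →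
      ∃ h : Q →ₗ[B] M (j+2), d (j+1) ∘ₗ h = f)

/-- Relative dominant dimension with respect to `Q`, as an element of `ℕ∞`. -/
def relDomDim (Q X : ModuleCat.{u} B) : ℕ∞ :=
  sSup {c : ℕ∞ | ∃ n : ℕ, c = n ∧ domdimGE B Q X n}

/-- Relative codominant dimension with respect to `Q`, as an element of `ℕ∞`. -/
def relCodomDim (Q X : ModuleCat.{u} B) : ℕ∞ :=
  sSup {c : ℕ∞ | ∃ n : ℕ, c = n ∧ codomdimGE B Q X n}

/-- A projective resolution. -/
structure ProjRes (X : ModuleCat.{u} B) where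
  P : ℕ → ModuleCat.{u} B
  d : ∀ j, P (j+1) →ₗ[B] P j
  aug : P 0 →ₗ[B] X
  proj : ∀ j, Module.Projective B (P j)
  augSurj : Function.Surjective aug
  exact0 : Function.Exact (d 0) aug
  exact : ∀ j, Function.Exact (d (j+1)) (d j)

/-- Vanishing of `Ext^i(X, Y)`, expressed via projective resolutions. -/
def ExtVanish (X Y : ModuleCat.{u} B) : ℕ → Prop
  | 0 => Subsingleton (X →ₗ[B] Y)
  | (i+1) => ∀ R : ProjRes B X, ∀ f : R.P (i+1) →ₗ[B] Y,
      f ∘ₗ R.d (i+1) = 0 → ∃ g : R.P i →ₗ[B] Y, f = g ∘ₗ R.d i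

/-- `Q` is self-orthogonal: `Ext^i(Q, Q) = 0` for all `i > 0`. -/
def SelfOrth (Q : ModuleCat.{u} B) : Prop := ∀ i, 1 ≤ i → ExtVanish B Q Q i

/-- `Z` is a (first, minimal) syzygy of `X`. -/
def IsSyzygyOf (X Z : ModuleCat.{u} B) : Prop :=
  ∃ (P : ModuleCat.{u} B) (p : P →ₗ[B] X), IsProjCover B p ∧
    Nonempty (Z ≃ₗ[B] LinearMap.ker p)

/-- `Z` is an `n`-th syzygy `Ω^n X`. -/
def IsOmegaOf : ℕ → ModuleCat.{u} B → ModuleCat.{u} B → Prop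
  | 0, X, Z => Nonempty (Z ≃ₗ[B] X)
  | (n+1), X, Z => ∃ Y, IsSyzygyOf B X Y ∧ IsOmegaOf n Y Z

/-- `Z` is a (first, minimal) cosyzygy of `X`. -/
def IsCosyzygyOf (X Z : ModuleCat.{u} B) : Prop :=
  ∃ (I : ModuleCat.{u} B) (ι : X →ₗ[B] I), IsInjEnvelope B ι ∧
    Nonempty (Z ≃ₗ[B] (I ⧸ LinearMap.range ι))

/-- `Z` is an `n`-th cosyzygy `Ω^{-n} X`. -/
def IsOmegaInvOf : ℕ → ModuleCat.{u} B → ModuleCat.{u} B → Prop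
  | 0, X, Z => Nonempty (Z ≃ₗ[B] X)
  | (n+1), X, Z => ∃ Y, IsCosyzygyOf B X Y ∧ IsOmegaInvOf n Y Z

/-- Precomposition with `g`, as a map of right `B`-modules `Hom(P₀,B) → Hom(P₁,B)`. -/
def lprecomp {P1 P0 : ModuleCat.{u} B} (g : P1 →ₗ[B] P0) :
    (P0 →ₗ[B] B) →ₗ[Bᵐᵒᵖ] (P1 →ₗ[B] B) where
  toFun h := h ∘ₗ g
  map_add' _ _ := rfl
  map_smul' _ _ := rfl

/-- `T` is a transpose `Tr X` (computed from a minimal projective presentation). -/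
def IsTransposeOf (X : ModuleCat.{u} B) (T : ModuleCat.{u} Bᵐᵒᵖ) : Prop :=
  ∃ (P1 P0 : ModuleCat.{u} B) (g : P1 →ₗ[B] P0) (p : P0 →ₗ[B] X),
    IsProjCover B p ∧ Module.Projective B P1 ∧ Function.Exact g p ∧
    Superfluous B (LinearMap.ker g) ∧
    Nonempty (T ≃ₗ[Bᵐᵒᵖ] ((P1 →ₗ[B] B) ⧸ LinearMap.range (lprecomp B g)))

/-- The canonical ring homomorphism `B →+* Bᵐᵒᵖᵐᵒᵖ`. -/
def opOpHom : B →+* Bᵐᵒᵖᵐᵒᵖ where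
  toFun b := op (op b)
  map_one' := rfl
  map_mul' _ _ := rfl
  map_zero' := rfl
  map_add' _ _ := rfl


/-- An `F_Mo`-projective resolution: terms in `add(B ⊕ Mo)`, exact, and remaining
exact under `Hom(Mo, −)`. -/
structure FProjRes (Mo X : ModuleCat.{u} B) where
  P : ℕ → ModuleCat.{u} B
  d : ∀ j, P (j+1) →ₗ[B] P j
  aug : P 0 →ₗ[B] X
  mem : ∀ j, InAdd B (ModuleCat.of B (B × Mo)) (P j)
  augSurj : Function.Surjective aug
  exact0 : Function.Exact (d 0) aug
  exact : ∀ j, Function.Exact (d (j+1)) (d j)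
  lift0 : ∀ f : Mo →ₗ[B] X, ∃ h : Mo →ₗ[B] P 0, aug ∘ₗ h = f
  lift1 : ∀ f : Mo →ₗ[B] P 0, aug ∘ₗ f = 0 → ∃ h : Mo →ₗ[B] P 1, d 0 ∘ₗ h = f
  lift : ∀ j, ∀ f : Mo →ₗ[B] P (j+1), d j ∘ₗ f = 0 →
    ∃ h : Mo →ₗ[B] P (j+2), d (j+1) ∘ₗ h = f

/-- Vanishing of the relative extension group `Ext^i_{F_Mo}(X, Y)`, computed via
`F_Mo`-projective resolutions. -/
def FExtVanish (Mo X Y : ModuleCat.{u} B) : ℕ → Prop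
  | 0 => True
  | (i+1) => ∀ R : FProjRes B Mo X, ∀ f : R.P (i+1) →ₗ[B] Y,
      f ∘ₗ R.d (i+1) = 0 → ∃ g : R.P i →ₗ[B] Y, f = g ∘ₗ R.d i

end RingDefs

section Duality
variable (k : Type u) [Field k] (B : Type u) [Ring B] [Algebra k B]

noncomputable instance kmod (X : ModuleCat.{u} B) : Module k X :=
  Module.compHom X (algebraMap k B)

instance kmodSMulComm (X : ModuleCat.{u} B) : SMulCommClass B k X :=
  ⟨fun b c x => by
    show b • ((algebraMap k B c) • x) = (algebraMap k B c) • (b • x)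
    rw [← mul_smul, ← mul_smul, Algebra.commutes]⟩

instance kmodTower (X : ModuleCat.{u} B) : IsScalarTower k B X :=
  ⟨fun c b x => by
    show (c • b) • x = (algebraMap k B c) • (b • x)
    rw [Algebra.smul_def, mul_smul]⟩

noncomputable instance dualModL (X : ModuleCat.{u} B) : Module Bᵐᵒᵖ (X →ₗ[k] k) where
  smul b φ := φ ∘ₗ (DistribMulAction.toLinearMap k X b.unop)
  one_smul φ := by
    ext x
    show φ ((1 : Bᵐᵒᵖ).unop • x) = φ x
    rw [unop_one, one_smul]
  mul_smul b c φ := by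
    ext x
    show φ ((b * c).unop • x) = φ (c.unop • b.unop • x)
    rw [unop_mul, mul_smul]
  smul_zero b := rfl
  smul_add b φ ψ := rfl
  add_smul b c φ := by
    ext x
    show φ ((b + c).unop • x) = φ (b.unop • x) + φ (c.unop • x)
    rw [unop_add, add_smul, map_add]
  zero_smul φ := by
    ext x
    show φ ((0 : Bᵐᵒᵖ).unop • x) = 0
    rw [unop_zero, zero_smul, map_zero]

/-- The standard duality `D = Hom_k(−, k)`, sending a left `B`-module to a right
`B`-module. -/
def Dop (X : ModuleCat.{u} B) : ModuleCat.{u} Bᵐᵒᵖ :=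
  ModuleCat.of Bᵐᵒᵖ (X →ₗ[k] k)

noncomputable instance dualModR (Y : ModuleCat.{u} Bᵐᵒᵖ) : Module B (Y →ₗ[k] k) where
  smul b φ := φ ∘ₗ (DistribMulAction.toLinearMap k Y (op b))
  one_smul φ := by
    ext x
    show φ ((op (1:B)) • x) = φ x
    rw [op_one, one_smul]
  mul_smul b c φ := by
    ext x
    show φ ((op (b * c)) • x) = φ ((op c) • (op b) • x)
    rw [op_mul, mul_smul]
  smul_zero b := rfl
  smul_add b φ ψ := rfl
  add_smul b c φ := by
    ext x
    show φ ((op (b + c)) • x) = φ ((op b) • x) + φ ((op c) • x)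
    rw [op_add, add_smul, map_add]
  zero_smul φ := by
    ext x
    show φ ((op (0 : B)) • x) = 0
    rw [op_zero, zero_smul, map_zero]

/-- The standard duality `D = Hom_k(−, k)`, sending a right `B`-module to a left
`B`-module. -/
def Dunop (Y : ModuleCat.{u} Bᵐᵒᵖ) : ModuleCat.{u} B :=
  ModuleCat.of B (Y →ₗ[k] k)

/-- `D(B_B)`, the standard injective cogenerator of `B`-Mod. -/
def Dcogen : ModuleCat.{u} B := Dunop k B (ModuleCat.of Bᵐᵒᵖ B)

/-- `T ≅ τ X = D Tr X`, the Auslander–Reiten translate. -/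
def IsTauOf (X T : ModuleCat.{u} B) : Prop :=
  ∃ Tr : ModuleCat.{u} Bᵐᵒᵖ, IsTransposeOf B X Tr ∧ Nonempty (T ≃ₗ[B] Dunop k B Tr)

/-- `T ≅ τ_n X = τ Ω^{n-1} X`. -/
def IsTauN (n : ℕ) (X T : ModuleCat.{u} B) : Prop :=
  ∃ Z, IsOmegaOf B (n-1) X Z ∧ IsTauOf k B Z T

/-- `T ≅ τ⁻ X = Tr D X`, the inverse Auslander–Reiten translate. -/
def IsTauInvOf (X T : ModuleCat.{u} B) : Prop :=
  ∃ Tr2 : ModuleCat.{u} Bᵐᵒᵖᵐᵒᵖ, IsTransposeOf Bᵐᵒᵖ (Dop k B X) Tr2 ∧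
    Nonempty (T ≃ₗ[B] ((ModuleCat.restrictScalars (opOpHom B)).obj Tr2))

/-- `T ≅ τ⁻_n X = τ⁻ Ω^{-(n-1)} X`. -/
def IsTauInvN (n : ℕ) (X T : ModuleCat.{u} B) : Prop :=
  ∃ Z, IsOmegaInvOf B (n-1) X Z ∧ IsTauInvOf k B Z T

/-- The Nakayama functor `ν = D Hom_B(−, B)` (on objects). -/
def nu (X : ModuleCat.{u} B) : ModuleCat.{u} B :=
  Dunop k B (ModuleCat.of Bᵐᵒᵖ (X →ₗ[B] B))

/-- The inverse Nakayama functor `ν⁻ = Hom_B(D(−), B)` (on objects). -/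
def nuInv (X : ModuleCat.{u} B) : ModuleCat.{u} B :=
  (ModuleCat.restrictScalars (opOpHom B)).obj
    (ModuleCat.of Bᵐᵒᵖᵐᵒᵖ ((Dop k B X) →ₗ[Bᵐᵒᵖ] Bᵐᵒᵖ))

/-- Relative `add Q`-dimension of `X` is at most `m`. -/
def RelAddDimLE (Q X : ModuleCat.{u} B) (m : ℕ) : Prop :=
  ResLE B Q (InAdd B Q) X m

/-- Relative `add Q`-codimension of `X` is at most `m`. -/
def RelAddCodimLE (Q X : ModuleCat.{u} B) (m : ℕ) : Prop :=
  CoresLE B Q (InAdd B Q) X m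

/-- `Q` is an `l`-quasi-generator (without minimality of `l`). -/
def QuasiGenLE (Q : ModuleCat.{u} B) (l : ℕ) : Prop :=
  CoresLE B Q (InAdd B Q) (ModuleCat.of B B) l

/-- `Q` is an `l`-quasi-generator: `l` is minimal. -/
def IsQuasiGen (Q : ModuleCat.{u} B) (l : ℕ) : Prop :=
  QuasiGenLE B Q l ∧ ∀ j, QuasiGenLE B Q j → l ≤ j

/-- `Q` is an `m`-quasi-cogenerator (without minimality of `m`). -/
def QuasiCogenLE (Q : ModuleCat.{u} B) (m : ℕ) : Prop :=
  ResLE B Q (InAdd B Q) (Dcogen k B) m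

/-- `Q` is an `m`-quasi-cogenerator: `m` is minimal. -/
def IsQuasiCogen (Q : ModuleCat.{u} B) (m : ℕ) : Prop :=
  QuasiCogenLE k B Q m ∧ ∀ j, QuasiCogenLE k B Q j → m ≤ j

/-- `(B, Q)` is a relative `n`-Auslander–Gorenstein pair. -/
def IsRelAGPair (Q : ModuleCat.{u} B) (n : ℕ) : Prop :=
  idLE B (ModuleCat.of B B) n ∧ idLE Bᵐᵒᵖ (ModuleCat.of Bᵐᵒᵖ Bᵐᵒᵖ) n ∧
  SelfOrth B Q ∧ domdimGE B Q (ModuleCat.of B B) n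

/-- `Q` is an `(n, m, l)`-quasi-precluster tilting module. -/
def IsQPCT (Q : ModuleCat.{u} B) (n m l : ℕ) : Prop :=
  (∀ i, 1 ≤ i → i ≤ n - 2 → ExtVanish B Q Q i) ∧
  IsQuasiGen B Q l ∧
  IsQuasiCogen k B Q m ∧
  (∃ T, IsTauN k B (n - m - 1) Q T ∧ RelAddDimLE B Q T m) ∧
  (∃ T, IsTauInvN k B (n - l - 1) Q T ∧ RelAddCodimLE B Q T l)

/-- Precomposition with `g`, as a `k`-linear map between Hom spaces. -/
def pcompk {X Y Z : ModuleCat.{u} B} (g : X →ₗ[B] Y) :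
    (Y →ₗ[B] Z) →ₗ[k] (X →ₗ[B] Z) where
  toFun h := h ∘ₗ g
  map_add' _ _ := rfl
  map_smul' _ _ := rfl


/-- `I` is an injective object for the exact structure `F_Mo`: it lies in
`add(DB ⊕ τ Mo)`. -/
def IsFInj (Mo I : ModuleCat.{u} B) : Prop :=
  ∃ T, IsTauOf k B Mo T ∧ InAdd B (ModuleCat.of B ((Dcogen k B) × T)) I

/-- `T` is an `F_Mo`-cotilting object: finite relative injective dimension, no relative
self-extensions, and the relative injectives `DB ⊕ τ Mo` admit a finite `F_Mo`-exact
resolution by objects of `add T`. -/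
def FCotilting (Mo T : ModuleCat.{u} B) : Prop :=
  (∃ r, CoresLE B Mo (IsFInj k B Mo) T r) ∧
  (∀ i, 1 ≤ i → FExtVanish B Mo T T i) ∧
  (∃ τM, IsTauOf k B Mo τM ∧
    ∃ r, ResLE B Mo (InAdd B T) (ModuleCat.of B ((Dcogen k B) × τM)) r)

end Duality

section EndStuff
variable (A : Type u) [Ring A] (Q : ModuleCat.{u} A)

/-- The canonical ring homomorphism `A → End_{End_A(Q)}(Q)`. -/
def toEndE : A →+* Module.End (Module.End A Q) Q where
  toFun a :=
    { toFun := fun q => a • q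
      map_add' := fun x y => smul_add a x y
      map_smul' := fun e q => (e.map_smul a q).symm }
  map_one' := by ext q; exact one_smul A q
  map_mul' x y := by ext q; exact mul_smul x y q
  map_zero' := by ext q; exact zero_smul A q
  map_add' x y := by ext q; exact add_smul x y q

/-- `Hom_A(Q, X)` as a left module over `End_A(Q)ᵐᵒᵖ` (i.e. a left `Λ`-module) by
precomposition. -/
noncomputable instance homPrecompMod (X : ModuleCat.{u} A) :
    Module (Module.End A Q)ᵐᵒᵖ (Q →ₗ[A] X) where
  smul e f := f ∘ₗ e.unop
  one_smul f := by ext q; rfl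
  mul_smul e e' f := by ext q; rfl
  smul_zero e := rfl
  smul_add e f g := rfl
  add_smul e e' f := by ext q; exact map_add f _ _
  zero_smul f := by ext q; exact map_zero f

/-- The actions of `A` and of `End_A(Q)` on `Q` commute. -/
instance endSMulComm : SMulCommClass (Module.End A Q) A Q :=
  ⟨fun e a q => e.map_smul a q⟩

instance endSMulComm' : SMulCommClass A (Module.End A Q) Q :=
  ⟨fun a e q => (e.map_smul a q).symm⟩

end EndStuff

end Paper
end

noncomputable section Part1
namespace Paper
open CategoryTheory CategoryTheory.Abelian

section EV
variable (R : Type) [Ring R]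

/-- Vanishing of `Ext^i_R(X,Y)`. -/
def EV (X Y : Type) [AddCommGroup X] [Module R X] [AddCommGroup Y] [Module R Y] (i : ℕ) : Prop :=
  Subsingleton (Ext (ModuleCat.of R X) (ModuleCat.of R Y) i)

variable {R}
variable {X Y K P C : Type} [AddCommGroup X] [Module R X] [AddCommGroup Y] [Module R Y]
  [AddCommGroup K] [Module R K] [AddCommGroup P] [Module R P] [AddCommGroup C] [Module R C]

theorem EV.zero {i : ℕ} (h : EV R X Y i) (x : Ext (ModuleCat.of R X) (ModuleCat.of R Y) i) :
    x = 0 := by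
  have : Subsingleton (Ext (ModuleCat.of R X) (ModuleCat.of R Y) i) := h
  exact Subsingleton.elim _ _

theorem EV.mk' {i : ℕ} (h : ∀ x : Ext (ModuleCat.of R X) (ModuleCat.of R Y) i, x = 0) :
    EV R X Y i := ⟨fun a b => (h a).trans (h b).symm⟩

theorem ev_proj [Module.Projective R X] {i : ℕ} (hi : 1 ≤ i) : EV R X Y i := by
  obtain ⟨j, rfl⟩ : ∃ j, i = j + 1 := ⟨i - 1, by omega⟩
  have : Projective (ModuleCat.of R X) := (IsProjective.iff_projective X).1 inferInstance
  exact Ext.subsingleton_of_projective _ _ j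

theorem ev_inj [Module.Injective R Y] {i : ℕ} (hi : 1 ≤ i) : EV R X Y i := by
  obtain ⟨j, rfl⟩ : ∃ j, i = j + 1 := ⟨i - 1, by omega⟩
  have : Injective (ModuleCat.of R Y) := Module.injective_object_of_injective_module R Y
  exact Ext.subsingleton_of_injective _ _ j

/-- retracts in the first variable -/
theorem EV.of_sum_left {i r : ℕ} (h : EV R X Y i) (s : Fin r → (C →ₗ[R] X)) (t : Fin r → (X →ₗ[R] C))
    (hst : ∑ a, t a ∘ₗ s a = LinearMap.id) : EV R C Y i := by
  refine EV.mk' fun x => ?_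
  have h1 : (∑ a, ModuleCat.ofHom (s a) ≫ ModuleCat.ofHom (t a)) = 𝟙 (ModuleCat.of R C) := by
    have : ∀ a, ModuleCat.ofHom (s a) ≫ ModuleCat.ofHom (t a) = ModuleCat.ofHom (t a ∘ₗ s a) :=
      fun a => rfl
    simp only [this]
    ext c
    have := congrArg (fun f => f c) hst
    simpa [ModuleCat.hom_sum] using this
  rw [← Ext.mk₀_id_comp x, ← h1, Ext.mk₀_sum, Ext.sum_comp]
  refine Finset.sum_eq_zero fun a _ => ?_
  rw [← Ext.mk₀_comp_mk₀_assoc, h.zero ((Ext.mk₀ (ModuleCat.ofHom (t a))).comp x _), Ext.comp_zero]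

theorem EV.congr_left {i : ℕ} (h : EV R X Y i) (e : X ≃ₗ[R] C) : EV R C Y i := by
  refine EV.of_sum_left (r := 1) h (fun _ => e.symm.toLinearMap) (fun _ => e.toLinearMap) ?_
  ext c; simp

theorem EV.congr_right {i : ℕ} (h : EV R X Y i) (e : Y ≃ₗ[R] C) : EV R X C i := by
  refine EV.mk' fun x => ?_
  have h1 : ModuleCat.ofHom e.symm.toLinearMap ≫ ModuleCat.ofHom e.toLinearMap
    = 𝟙 (ModuleCat.of R C) := by
    ext c; simp
  rw [← Ext.comp_mk₀_id x, ← h1, ← Ext.mk₀_comp_mk₀, ← Ext.comp_assoc_of_second_deg_zero,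
    h.zero (x.comp _ _), Ext.zero_comp]

/-- the short complex -/
abbrev sc (f : K →ₗ[R] P) (g : P →ₗ[R] C) (hfg : Function.Exact f g) : ShortComplex (ModuleCat.{0} R) :=
  ShortComplex.mk (ModuleCat.ofHom f) (ModuleCat.ofHom g) (by
    ext x; exact (hfg _).2 ⟨x, rfl⟩)

theorem sc_exact (f : K →ₗ[R] P) (g : P →ₗ[R] C) (hf : Function.Injective f)
    (hfg : Function.Exact f g) (hg : Function.Surjective g)
    : (sc f g hfg).ShortExact where
  exact := (ShortComplex.ShortExact.moduleCat_exact_iff_function_exact _).2 hfg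
  mono_f := (ModuleCat.mono_iff_injective _).2 hf
  epi_g := (ModuleCat.epi_iff_surjective _).2 hg

theorem ev_sub (f : K →ₗ[R] P) (g : P →ₗ[R] C) (hf : Function.Injective f)
    (hfg : Function.Exact f g) (hg : Function.Surjective g)
    {i : ℕ} (h1 : EV R P Y i) (h2 : EV R C Y (i+1)) : EV R K Y i := by
  refine EV.mk' fun x => ?_
  obtain ⟨x2, hx⟩ := Ext.contravariant_sequence_exact₁ (sc_exact f g hf hfg hg) _ x
    (show 1 + i = i + 1 by omega) (EV.zero h2 _)
  rw [← hx, EV.zero h1 x2, Ext.comp_zero]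

theorem ev_quot (f : K →ₗ[R] P) (g : P →ₗ[R] C) (hf : Function.Injective f)
    (hfg : Function.Exact f g) (hg : Function.Surjective g)
    {i : ℕ} (h1 : EV R K Y i) (h2 : EV R P Y (i+1)) : EV R C Y (i+1) := by
  refine EV.mk' fun x => ?_
  obtain ⟨x2, hx⟩ := Ext.contravariant_sequence_exact₃ (sc_exact f g hf hfg hg) _ x
    (EV.zero h2 _) (show 1 + i = i + 1 by omega)
  rw [← hx, EV.zero h1 x2, Ext.comp_zero]

theorem extend_of_ev (f : K →ₗ[R] P) (g : P →ₗ[R] C) (hf : Function.Injective f)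
    (hfg : Function.Exact f g) (hg : Function.Surjective g)
    (h : EV R C Y 1) (u : K →ₗ[R] Y) : ∃ v : P →ₗ[R] Y, v ∘ₗ f = u := by
  obtain ⟨x2, hx⟩ := Ext.contravariant_sequence_exact₁ (sc_exact f g hf hfg hg) _
    (Ext.mk₀ (ModuleCat.ofHom u)) (show 1 + 0 = 1 by omega) (EV.zero h _)
  obtain ⟨v, rfl⟩ := (Ext.mk₀_bijective _ _).2 x2
  rw [Ext.mk₀_comp_mk₀] at hx
  have := (Ext.mk₀_bijective _ _).1 hx
  refine ⟨v.hom, ?_⟩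
  exact congrArg ModuleCat.Hom.hom this

theorem ev_one_of_extend (f : K →ₗ[R] P) (g : P →ₗ[R] C) (hf : Function.Injective f)
    (hfg : Function.Exact f g) (hg : Function.Surjective g)
    (h : EV R P Y 1) (he : ∀ u : K →ₗ[R] Y, ∃ v : P →ₗ[R] Y, v ∘ₗ f = u) :
    EV R C Y 1 := by
  refine EV.mk' fun x => ?_
  obtain ⟨x2, hx⟩ := Ext.contravariant_sequence_exact₃ (sc_exact f g hf hfg hg) _ x
    (EV.zero h _) (show 1 + 0 = 1 by omega)
  obtain ⟨u, rfl⟩ := (Ext.mk₀_bijective _ _).2 x2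
  obtain ⟨v, hv⟩ := he u.hom
  have : u = (sc f g hfg).f ≫ ModuleCat.ofHom v := by
    ext x; exact (congrArg (fun f => f x) hv).symm
  rw [← hx, this, ← Ext.mk₀_comp_mk₀, (sc_exact f g hf hfg hg).extClass_comp_assoc]

theorem ev_cquot (f : K →ₗ[R] P) (g : P →ₗ[R] C) (hf : Function.Injective f)
    (hfg : Function.Exact f g) (hg : Function.Surjective g)
    {i : ℕ} (h1 : EV R X P i) (h2 : EV R X K (i+1)) : EV R X C i := by
  refine EV.mk' fun x => ?_
  obtain ⟨x2, hx⟩ := Ext.covariant_sequence_exact₃ _ (sc_exact f g hf hfg hg) x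
    (show i + 1 = i + 1 by omega) (EV.zero h2 _)
  rw [← hx, EV.zero h1 x2, Ext.zero_comp]

theorem ev_csub (f : K →ₗ[R] P) (g : P →ₗ[R] C) (hf : Function.Injective f)
    (hfg : Function.Exact f g) (hg : Function.Surjective g)
    {i : ℕ} (h1 : EV R X C i) (h2 : EV R X P (i+1)) : EV R X K (i+1) := by
  refine EV.mk' fun x => ?_
  obtain ⟨x2, hx⟩ := Ext.covariant_sequence_exact₁ _ (sc_exact f g hf hfg hg) x
    (EV.zero h2 _) (show i + 1 = i + 1 by omega)
  rw [← hx, EV.zero h1 x2, Ext.zero_comp]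

theorem lift_of_ev (f : K →ₗ[R] P) (g : P →ₗ[R] C) (hf : Function.Injective f)
    (hfg : Function.Exact f g) (hg : Function.Surjective g)
    (h : EV R X K 1) (u : X →ₗ[R] C) : ∃ v : X →ₗ[R] P, g ∘ₗ v = u := by
  obtain ⟨x2, hx⟩ := Ext.covariant_sequence_exact₃ _ (sc_exact f g hf hfg hg)
    (Ext.mk₀ (ModuleCat.ofHom u)) (show 0 + 1 = 1 by omega) (EV.zero h _)
  obtain ⟨v, rfl⟩ := (Ext.mk₀_bijective _ _).2 x2
  rw [Ext.mk₀_comp_mk₀] at hx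
  have := (Ext.mk₀_bijective _ _).1 hx
  exact ⟨v.hom, congrArg ModuleCat.Hom.hom this⟩

theorem ev_one_of_lift (f : K →ₗ[R] P) (g : P →ₗ[R] C) (hf : Function.Injective f)
    (hfg : Function.Exact f g) (hg : Function.Surjective g)
    (h : EV R X P 1) (he : ∀ u : X →ₗ[R] C, ∃ v : X →ₗ[R] P, g ∘ₗ v = u) :
    EV R X K 1 := by
  refine EV.mk' fun x => ?_
  obtain ⟨x2, hx⟩ := Ext.covariant_sequence_exact₁ _ (sc_exact f g hf hfg hg) x
    (EV.zero h _) (show 0 + 1 = 1 by omega)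
  obtain ⟨u, rfl⟩ := (Ext.mk₀_bijective _ _).2 x2
  obtain ⟨v, hv⟩ := he u.hom
  have : u = ModuleCat.ofHom v ≫ (sc f g hfg).g := by
    ext x; exact (congrArg (fun f => f x) hv).symm
  rw [← hx, this, ← Ext.mk₀_comp_mk₀, Ext.comp_assoc_of_second_deg_zero,
    (sc_exact f g hf hfg hg).comp_extClass, Ext.comp_zero]

end EV

end Paper
end Part1

noncomputable section Part2
namespace Paper

section Bridge
variable {R : Type} [Ring R]

theorem exact_mkQ {X P : Type} [AddCommGroup X] [Module R X] [AddCommGroup P] [Module R P]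
    (f : X →ₗ[R] P) : Function.Exact f (LinearMap.range f).mkQ := by
  intro y; simp

theorem exact_ker {X P : Type} [AddCommGroup X] [Module R X] [AddCommGroup P] [Module R P]
    (f : X →ₗ[R] P) : Function.Exact (LinearMap.ker f).subtype f := by
  intro y; simp

theorem ev_of_cores (m : ℕ) : ∀ (X : ModuleCat.{0} R) (M : ℕ → ModuleCat.{0} R)
    (ι : X →ₗ[R] M 0) (d : ∀ j, M j →ₗ[R] M (j+1)),
    (∀ j, j ≤ m → Module.Injective R (M j)) → (∀ j, m < j → Subsingleton (M j)) →
    Function.Injective ι → Function.Exact ι (d 0) →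
    (∀ j, Function.Exact (d j) (d (j+1))) →
    ∀ (Y : Type) [AddCommGroup Y] [Module R Y] (i : ℕ), m < i → EV R Y X i := by
  induction m with
  | zero =>
    intro X M ι d hM hs hi he hd Y _ _ i hlt
    have := hM 0 le_rfl
    have := hs 1 (by omega)
    have hsurj : Function.Surjective ι := fun y => (he y).1 (Subsingleton.elim _ _)
    exact (ev_inj (R := R) (X := Y) (Y := M 0) hlt).congr_right
      (LinearEquiv.ofBijective ι ⟨hi, hsurj⟩).symm
  | succ m ih =>
    intro X M ι d hM hs hi he hd Y _ _ i hlt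
    obtain ⟨i, rfl⟩ : ∃ j, i = j + 1 := ⟨i - 1, by omega⟩
    have := hM 0 (by omega)
    let q := (LinearMap.range ι).mkQ
    have hle : LinearMap.range ι ≤ LinearMap.ker (d 0) := by
      rintro _ ⟨x, rfl⟩; exact (he _).2 ⟨x, rfl⟩
    let ι' : (M 0 ⧸ LinearMap.range ι) →ₗ[R] M 1 := (LinearMap.range ι).liftQ (d 0) hle
    have key := ih (ModuleCat.of R (M 0 ⧸ LinearMap.range ι)) (fun j => M (j+1)) ι'
      (fun j => d (j+1)) (fun j hj => hM _ (by omega)) (fun j hj => hs _ (by omega))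
      (by
        rw [← LinearMap.ker_eq_bot]
        refine Submodule.ker_liftQ_eq_bot _ _ _ ?_
        intro y hy; exact (he y).1 hy)
      (by
        intro y
        rw [hd 0 y]
        constructor
        · rintro ⟨x, rfl⟩; exact ⟨q x, rfl⟩
        · rintro ⟨x, rfl⟩
          obtain ⟨x, rfl⟩ := Submodule.mkQ_surjective _ x
          exact ⟨x, rfl⟩)
      (fun j => hd _) Y i (by omega)
    exact ev_csub ι q hi (exact_mkQ ι) (Submodule.mkQ_surjective _) key (ev_inj (by omega))

theorem ev_of_idLE {X : ModuleCat.{0} R} {m : ℕ} (h : idLE R X m)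
    (Y : Type) [AddCommGroup Y] [Module R Y] (i : ℕ) (hi : m < i) : EV R Y X i := by
  obtain ⟨M, ι, d, h1, h2, h3, h4, h5, -⟩ := h
  exact ev_of_cores m X M ι d h1 h2 h3 h4 h5 Y i hi

theorem ev_of_res (m : ℕ) : ∀ (X : ModuleCat.{0} R) (M : ℕ → ModuleCat.{0} R)
    (d : ∀ j, M (j+1) →ₗ[R] M j) (ε : M 0 →ₗ[R] X),
    (∀ j, j ≤ m → Module.Projective R (M j)) → (∀ j, m < j → Subsingleton (M j)) →
    Function.Surjective ε → Function.Exact (d 0) ε →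
    (∀ j, Function.Exact (d (j+1)) (d j)) →
    ∀ (Y : Type) [AddCommGroup Y] [Module R Y] (i : ℕ), m < i → EV R X Y i := by
  induction m with
  | zero =>
    intro X M d ε hM hs hi he hd Y _ _ i hlt
    have := hM 0 le_rfl
    have := hs 1 (by omega)
    have hinj : Function.Injective ε := by
      rw [← LinearMap.ker_eq_bot, LinearMap.ker_eq_bot']
      intro y hy
      obtain ⟨z, rfl⟩ := (he y).1 hy
      rw [Subsingleton.elim z 0, map_zero]
    exact (ev_proj (R := R) (X := M 0) (Y := Y) hlt).congr_left
      (LinearEquiv.ofBijective ε ⟨hinj, hi⟩)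
  | succ m ih =>
    intro X M d ε hM hs hi he hd Y _ _ i hlt
    obtain ⟨i, rfl⟩ : ∃ j, i = j + 1 := ⟨i - 1, by omega⟩
    have := hM 0 (by omega)
    let ε' : M 1 →ₗ[R] LinearMap.ker ε := (d 0).codRestrict _ (fun x => (he _).2 ⟨x, rfl⟩)
    have key := ih (ModuleCat.of R (LinearMap.ker ε)) (fun j => M (j+1))
      (fun j => d (j+1)) ε' (fun j hj => hM _ (by omega)) (fun j hj => hs _ (by omega))
      (by
        rintro ⟨y, hy⟩
        obtain ⟨z, hz⟩ := (he y).1 hy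
        exact ⟨z, Subtype.ext hz⟩)
      (by
        intro y
        rw [← hd 0 y]
        exact Subtype.ext_iff)
      (fun j => hd _) Y i (by omega)
    exact ev_quot (LinearMap.ker ε).subtype ε (Subtype.val_injective) (exact_ker ε) hi key
      (ev_proj (by omega))

theorem ev_of_pdLE {X : ModuleCat.{0} R} {m : ℕ} (h : pdLE R X m)
    (Y : Type) [AddCommGroup Y] [Module R Y] (i : ℕ) (hi : m < i) : EV R X Y i := by
  obtain ⟨M, d, ε, h1, h2, h3, h4, h5, -⟩ := h
  exact ev_of_res m X M d ε h1 h2 h3 h4 h5 Y i hi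

theorem ev_of_projRes (i : ℕ) : ∀ (X : ModuleCat.{0} R) (S : ProjRes R X)
    (Y : Type) [AddCommGroup Y] [Module R Y],
    (∀ f : S.P (i+1) →ₗ[R] Y, f ∘ₗ S.d (i+1) = 0 → ∃ g : S.P i →ₗ[R] Y, f = g ∘ₗ S.d i) →
    EV R X Y (i+1) := by
  induction i with
  | zero =>
    intro X S Y _ _ h
    have := S.proj 0
    refine ev_one_of_extend (LinearMap.ker S.aug).subtype S.aug Subtype.val_injective
      (exact_ker _) S.augSurj (ev_proj le_rfl) ?_
    intro u
    let ε' : S.P 1 →ₗ[R] LinearMap.ker S.aug :=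
      (S.d 0).codRestrict _ (fun x => (S.exact0 _).2 ⟨x, rfl⟩)
    obtain ⟨g, hg⟩ := h (u ∘ₗ ε') (by
      ext x
      have : ε' (S.d 1 x) = 0 := Subtype.ext ((S.exact 0 _).2 ⟨x, rfl⟩)
      simp [this])
    refine ⟨g, ?_⟩
    ext ⟨y, hy⟩
    obtain ⟨z, rfl⟩ := (S.exact0 y).1 hy
    exact (congrArg (fun f => f z) hg).symm
  | succ i ih =>
    intro X S Y _ _ h
    have := S.proj 0
    let ε' : S.P 1 →ₗ[R] LinearMap.ker S.aug :=
      (S.d 0).codRestrict _ (fun x => (S.exact0 _).2 ⟨x, rfl⟩)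
    let S' : ProjRes R (ModuleCat.of R (LinearMap.ker S.aug)) :=
      { P := fun j => S.P (j+1)
        d := fun j => S.d (j+1)
        aug := ε'
        proj := fun j => S.proj _
        augSurj := by
          rintro ⟨y, hy⟩
          obtain ⟨z, hz⟩ := (S.exact0 y).1 hy
          exact ⟨z, Subtype.ext hz⟩
        exact0 := by
          intro y
          rw [← S.exact 0 y]
          exact Subtype.ext_iff
        exact := fun j => S.exact _ }
    have key := ih _ S' Y h
    exact ev_quot (LinearMap.ker S.aug).subtype S.aug (Subtype.val_injective) (exact_ker S.aug)
      S.augSurj key (ev_proj (by omega))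

/-- iterated syzygies by free covers -/
def syzSeq (X : ModuleCat.{0} R) : ℕ → ModuleCat.{0} R
  | 0 => X
  | (j+1) => ModuleCat.of R (LinearMap.ker (Finsupp.linearCombination R (id : syzSeq X j → syzSeq X j)))

/-- the standard free resolution -/
def stdRes (X : ModuleCat.{0} R) : ProjRes R X where
  P := fun j => ModuleCat.of R (syzSeq X j →₀ R)
  d := fun j => (LinearMap.ker (Finsupp.linearCombination R (id : syzSeq X j → syzSeq X j))).subtype ∘ₗ
    (Finsupp.linearCombination R (id : syzSeq X (j+1) → syzSeq X (j+1)))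
  aug := Finsupp.linearCombination R (id : X → X)
  proj := fun j => (inferInstance : Module.Projective R (syzSeq X j →₀ R))
  augSurj := Finsupp.linearCombination_id_surjective R X
  exact0 := by
    intro y
    constructor
    · intro hy
      obtain ⟨z, hz⟩ := Finsupp.linearCombination_id_surjective R (syzSeq X 1) ⟨y, hy⟩
      exact ⟨z, congrArg Subtype.val hz⟩
    · rintro ⟨z, rfl⟩
      exact (Finsupp.linearCombination R (id : syzSeq X 1 → syzSeq X 1) z).2
  exact := by
    intro j y
    constructor
    · intro hy
      have hy' : y ∈ LinearMap.ker (Finsupp.linearCombination R (id : syzSeq X (j+1) → syzSeq X (j+1))) :=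
        Subtype.ext hy
      obtain ⟨z, hz⟩ := Finsupp.linearCombination_id_surjective R (syzSeq X (j+2)) ⟨y, hy'⟩
      exact ⟨z, congrArg Subtype.val hz⟩
    · rintro ⟨z, rfl⟩
      exact congrArg Subtype.val
        (Finsupp.linearCombination R (id : syzSeq X (j+2) → syzSeq X (j+2)) z).2

theorem ev_of_selfOrth {Q : ModuleCat.{0} R} (h : SelfOrth R Q) {i : ℕ} (hi : 1 ≤ i) :
    EV R Q Q i := by
  obtain ⟨i, rfl⟩ : ∃ j, i = j + 1 := ⟨i - 1, by omega⟩
  exact ev_of_projRes i Q (stdRes Q) Q (h (i+1) hi (stdRes Q))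

/-- data of a member of `add` in sum form -/
theorem inAdd_iff {Q X : ModuleCat.{0} R} : InAdd R Q X ↔
    ∃ (r : ℕ) (s : Fin r → (X →ₗ[R] Q)) (t : Fin r → (Q →ₗ[R] X)),
      ∀ x, ∑ a, t a (s a x) = x := by
  constructor
  · rintro ⟨r, s, t, h⟩
    refine ⟨r, fun a => LinearMap.proj a ∘ₗ s, fun a => t ∘ₗ LinearMap.single R (fun _ => Q) a, ?_⟩
    intro x
    have h1 := congrArg (fun f => f x) h
    simp only [LinearMap.comp_apply, LinearMap.id_apply] at h1
    simp only [LinearMap.comp_apply, LinearMap.proj_apply, LinearMap.coe_single]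
    rw [← map_sum]
    conv_rhs => rw [← h1]
    congr 1
    exact Finset.univ_sum_single (s x)
  · rintro ⟨r, s, t, h⟩
    refine ⟨r, LinearMap.pi s, ∑ a, t a ∘ₗ LinearMap.proj a, ?_⟩
    ext x
    simpa using h x

theorem EV.inAdd {Q X : ModuleCat.{0} R} {Y : Type} [AddCommGroup Y] [Module R Y] {i : ℕ}
    (h : EV R Q Y i) (hX : InAdd R Q X) : EV R X Y i := by
  obtain ⟨r, s, t, hst⟩ := inAdd_iff.1 hX
  exact EV.of_sum_left h s t (by ext x; simpa using hst x)

theorem InAdd.of_sum {Q X W : ModuleCat.{0} R} (hX : InAdd R Q X)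
    {r : ℕ} (s : Fin r → (W →ₗ[R] X)) (t : Fin r → (X →ₗ[R] W))
    (h : ∀ x, ∑ a, t a (s a x) = x) : InAdd R Q W := by
  obtain ⟨r', s', t', hst⟩ := inAdd_iff.1 hX
  refine inAdd_iff.2 ⟨r * r', fun c => s' (finProdFinEquiv.symm c).2 ∘ₗ s (finProdFinEquiv.symm c).1,
    fun c => t (finProdFinEquiv.symm c).1 ∘ₗ t' (finProdFinEquiv.symm c).2, fun x => ?_⟩
  rw [← finProdFinEquiv.sum_comp]
  simp only [Equiv.symm_apply_apply, Fintype.sum_prod_type, LinearMap.comp_apply]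
  simp only [← map_sum, hst, h]

theorem InAdd.retract {Q X W : ModuleCat.{0} R} (hX : InAdd R Q X)
    (s : W →ₗ[R] X) (t : X →ₗ[R] W) (h : ∀ x, t (s x) = x) : InAdd R Q W :=
  hX.of_sum (r := 1) (fun _ => s) (fun _ => t) (by simpa using h)

theorem inAdd_self (Q : ModuleCat.{0} R) : InAdd R Q Q :=
  inAdd_iff.2 ⟨1, fun _ => LinearMap.id, fun _ => LinearMap.id, by simp⟩

theorem InAdd.trans {Q X W : ModuleCat.{0} R} (hX : InAdd R Q X) (hW : InAdd R X W) :
    InAdd R Q W := by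
  obtain ⟨r', s', t', hst⟩ := inAdd_iff.1 hW
  exact hX.of_sum s' t' hst

theorem InAdd.finite {Q X : ModuleCat.{0} R} (hX : InAdd R Q X) [Module.Finite R Q] :
    Module.Finite R X := by
  obtain ⟨r, s, t, h⟩ := hX
  exact Module.Finite.of_surjective t (fun x => ⟨s x, congrArg (fun f => f x) h⟩)

theorem inAdd_of_proj (P : ModuleCat.{0} R) [Module.Finite R P] [Module.Projective R P] :
    InAdd R (ModuleCat.of R R) P := by
  obtain ⟨r, f, hf⟩ := Module.Finite.exists_fin' R P
  obtain ⟨g, hg⟩ := Module.projective_lifting_property f LinearMap.id hf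
  exact ⟨r, g, f, hg⟩

theorem InAdd.projective {P : ModuleCat.{0} R} (h : InAdd R (ModuleCat.of R R) P) :
    Module.Projective R P := by
  obtain ⟨r, s, t, h⟩ := h
  exact Module.Projective.of_split (M := Fin r → R) s t h

end Bridge
end Paper
end Part2

noncomputable section Part3
namespace Paper

section Refl
variable {A : Type} [Ring A] (Q : ModuleCat.{0} A)

/-- `V` is cogenerated by `Q`. -/
def Cogen (V : Type) [AddCommGroup V] [Module A V] : Prop :=
  ∀ v : V, (∀ f : V →ₗ[A] Q, f v = 0) → v = 0

/-- The evaluation map into the double `Q`-dual is surjective. -/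
def EvSurj (V : Type) [AddCommGroup V] [Module A V] : Prop :=
  ∀ φ : (V →ₗ[A] Q) →ₗ[Module.End A Q] Q, ∃ v : V, ∀ f, φ f = f v

/-- precomposition as an `End Q`-linear map -/
def hmap {V W : Type} [AddCommGroup V] [Module A V] [AddCommGroup W] [Module A W]
    (g : V →ₗ[A] W) : (W →ₗ[A] Q) →ₗ[Module.End A Q] (V →ₗ[A] Q) where
  toFun h := h ∘ₗ g
  map_add' _ _ := rfl
  map_smul' _ _ := rfl

@[simp] theorem hmap_apply {V W : Type} [AddCommGroup V] [Module A V] [AddCommGroup W] [Module A W]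
    (g : V →ₗ[A] W) (h : W →ₗ[A] Q) : hmap Q g h = h ∘ₗ g := rfl

variable {Q}

/-- factor a map through a surjection -/
theorem exists_factor {V M W N : Type} [AddCommGroup V] [Module A V] [AddCommGroup M] [Module A M]
    [AddCommGroup W] [Module A W] [AddCommGroup N] [Module A N] (f : V →ₗ[A] M) (g : M →ₗ[A] W)
    (hfg : Function.Exact f g) (hg : Function.Surjective g) (u : M →ₗ[A] N) (hu : u ∘ₗ f = 0) :
    ∃ v : W →ₗ[A] N, v ∘ₗ g = u := by
  have hk : LinearMap.ker g ≤ LinearMap.ker u := by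
    intro y hy
    obtain ⟨x, rfl⟩ := (hfg y).1 hy
    exact congrArg (fun g => g x) hu
  refine ⟨(LinearMap.ker g).liftQ u hk ∘ₗ (g.quotKerEquivOfSurjective hg).symm.toLinearMap, ?_⟩
  ext x
  have : (g.quotKerEquivOfSurjective hg).symm (g x) = (LinearMap.ker g).mkQ x := by
    rw [LinearEquiv.symm_apply_eq]; rfl
  simp [this]

theorem hmap_inj {M W : Type} [AddCommGroup M] [Module A M]
    [AddCommGroup W] [Module A W] (g : M →ₗ[A] W) (hg : Function.Surjective g) :
    Function.Injective (hmap Q g) := by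
  intro u v huv
  ext x
  obtain ⟨y, rfl⟩ := hg x
  exact congrArg (fun g => g y) huv

theorem hmap_exact {V M W : Type} [AddCommGroup V] [Module A V] [AddCommGroup M] [Module A M]
    [AddCommGroup W] [Module A W] (f : V →ₗ[A] M) (g : M →ₗ[A] W)
    (hfg : Function.Exact f g) (hg : Function.Surjective g) :
    Function.Exact (hmap Q g) (hmap Q f) := by
  intro u
  constructor
  · intro hu
    obtain ⟨v, hv⟩ := exists_factor f g hfg hg u hu
    exact ⟨v, hv⟩
  · rintro ⟨v, rfl⟩
    ext x
    have : g (f x) = 0 := (hfg _).2 ⟨x, rfl⟩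
    simp [this]

theorem EvSurj.inAdd {V X : ModuleCat.{0} A} (h : EvSurj Q V) (hX : InAdd A V X) : EvSurj Q X := by
  obtain ⟨r, s, t, hst⟩ := inAdd_iff.1 hX
  intro φ
  choose v hv using fun a => h (φ ∘ₗ hmap Q (s a))
  refine ⟨∑ a, t a (v a), fun f => ?_⟩
  have hf : f = ∑ a, hmap Q (s a) (f ∘ₗ t a) := by
    ext x
    rw [LinearMap.sum_apply]
    simp only [hmap_apply, LinearMap.comp_apply]
    rw [← map_sum, hst]
  conv_lhs => rw [hf]
  rw [map_sum, map_sum]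
  exact Finset.sum_congr rfl fun a _ => hv a (f ∘ₗ t a)

theorem evSurj_self : EvSurj Q Q := by
  intro φ
  refine ⟨φ LinearMap.id, fun f => ?_⟩
  have : f = (f : Module.End A Q) • (LinearMap.id : Q →ₗ[A] Q) := by ext; rfl
  conv_lhs => rw [this]
  rw [map_smul]; rfl

theorem Cogen.inAdd {V X : ModuleCat.{0} A} (h : Cogen Q V) (hX : InAdd A V X) : Cogen Q X := by
  obtain ⟨r, s, t, hst⟩ := inAdd_iff.1 hX
  intro x hx
  rw [← hst x]
  refine Finset.sum_eq_zero fun a _ => ?_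
  rw [h (s a x) (fun f => hx (f ∘ₗ s a)), map_zero]

theorem cogen_self : Cogen Q Q := fun v hv => hv LinearMap.id

theorem Cogen.of_inj {V X : Type} [AddCommGroup V] [Module A V] [AddCommGroup X] [Module A X]
    (h : Cogen Q V) (f : X →ₗ[A] V) (hf : Function.Injective f) : Cogen Q X := by
  intro x hx
  exact hf (by rw [map_zero]; exact h _ fun g => hx (g ∘ₗ f))

/-- kernels -/
theorem EvSurj.ker {V M W : Type} [AddCommGroup V] [Module A V] [AddCommGroup M] [Module A M]
    [AddCommGroup W] [Module A W] (f : V →ₗ[A] M) (g : M →ₗ[A] W)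
    (hfg : Function.Exact f g) (hM : EvSurj Q M) (hW : Cogen Q W)
    (hext : ∀ u : V →ₗ[A] Q, ∃ v : M →ₗ[A] Q, v ∘ₗ f = u) : EvSurj Q V := by
  intro φ
  obtain ⟨m, hm⟩ := hM (φ ∘ₗ hmap Q f)
  have hgm : g m = 0 := by
    refine hW _ fun u => ?_
    have h1 := hm (u ∘ₗ g)
    have h2 : hmap Q f (u ∘ₗ g) = 0 := by
      ext x
      have : g (f x) = 0 := (hfg _).2 ⟨x, rfl⟩
      simp [this]
    rw [LinearMap.comp_apply, h2, map_zero] at h1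
    exact h1.symm
  obtain ⟨v, rfl⟩ := (hfg m).1 hgm
  refine ⟨v, fun u => ?_⟩
  obtain ⟨w, rfl⟩ := hext u
  exact hm w

/-- `Hom(-,Q)` sends `add V` to `add Hom(V,Q)`. -/
theorem InAdd.hom {V X : ModuleCat.{0} A} (h : InAdd A V X) :
    InAdd (Module.End A Q) (ModuleCat.of _ (V →ₗ[A] Q)) (ModuleCat.of _ (X →ₗ[A] Q)) := by
  obtain ⟨r, s, t, hst⟩ := inAdd_iff.1 h
  refine inAdd_iff.2 ⟨r, fun a => hmap Q (t a), fun a => hmap Q (s a), fun f => ?_⟩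
  change ∑ a, (f ∘ₗ t a) ∘ₗ s a = f
  ext x
  rw [LinearMap.sum_apply]
  simp only [LinearMap.comp_apply]
  rw [← map_sum, hst]

theorem InAdd.hom_proj {X : ModuleCat.{0} A} (h : InAdd A Q X) :
    Module.Projective (Module.End A Q) (X →ₗ[A] Q) :=
  InAdd.projective (R := Module.End A Q) (P := ModuleCat.of _ (X →ₗ[A] Q)) (h.hom (Q := Q))

theorem InAdd.hom_free {X : ModuleCat.{0} A} (h : InAdd A (ModuleCat.of A A) X) :
    InAdd (Module.End A Q) (ModuleCat.of _ Q) (ModuleCat.of _ (X →ₗ[A] Q)) := by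
  refine InAdd.trans (InAdd.retract (inAdd_self _) ?_ ?_ ?_) (h.hom (Q := Q))
  · exact (LinearMap.ringLmapEquivSelf A (Module.End A Q) Q).toLinearMap
  · exact (LinearMap.ringLmapEquivSelf A (Module.End A Q) Q).symm.toLinearMap
  · intro x
    exact (LinearMap.ringLmapEquivSelf A (Module.End A Q) Q).symm_apply_apply x

/-- one step in a dominant dimension sequence -/
theorem domdim_step {X : ModuleCat.{0} A} {n : ℕ} (h : domdimGE A Q X (n+1)) :
    ∃ (M : ModuleCat.{0} A) (ι : X →ₗ[A] M), InAdd A Q M ∧ Function.Injective ι ∧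
      (∀ f : X →ₗ[A] Q, ∃ h : M →ₗ[A] Q, h ∘ₗ ι = f) ∧
      domdimGE A Q (ModuleCat.of A (M ⧸ LinearMap.range ι)) n := by
  obtain h | ⟨M, ι, d, h1, h2, h3, h4, h5, h6, h7⟩ := h
  · omega
  refine ⟨M 0, ι, h1 0 (by omega), h2, h5, ?_⟩
  rcases Nat.eq_zero_or_pos n with rfl | hn
  · exact Or.inl rfl
  have he := h3 (by omega)
  have hle : LinearMap.range ι ≤ LinearMap.ker (d 0) := by
    rintro _ ⟨x, rfl⟩; exact (he _).2 ⟨x, rfl⟩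
  let ι' : (M 0 ⧸ LinearMap.range ι) →ₗ[A] M 1 := (LinearMap.range ι).liftQ (d 0) hle
  refine Or.inr ⟨fun j => M (j+1), ι', fun j => d (j+1), fun j hj => h1 _ (by omega), ?_, ?_,
    fun j hj => h4 _ (by omega), ?_, ?_, fun j hj => h7 _ (by omega)⟩
  · rw [← LinearMap.ker_eq_bot]
    refine Submodule.ker_liftQ_eq_bot _ _ _ ?_
    intro y hy; exact (he y).1 hy
  · intro h2n y
    rw [h4 0 (by omega) y]
    constructor
    · rintro ⟨x, rfl⟩; exact ⟨(LinearMap.range ι).mkQ x, rfl⟩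
    · rintro ⟨x, rfl⟩
      obtain ⟨x, rfl⟩ := Submodule.mkQ_surjective _ x
      exact ⟨x, rfl⟩
  · intro f
    obtain ⟨h, hh⟩ := h6 (by omega) (f ∘ₗ (LinearMap.range ι).mkQ) (by
      ext x
      simp only [LinearMap.comp_apply, LinearMap.zero_apply]
      have : (LinearMap.range ι).mkQ (ι x) = 0 := by simp
      rw [this, map_zero])
    refine ⟨h, ?_⟩
    refine Submodule.linearMap_qext _ ?_
    rw [← hh]; rfl
  · intro h2n f hf
    exact h7 0 (by omega) f (by ext x; exact congrArg (fun g => g ((LinearMap.range ι).mkQ x)) hf)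

theorem domdim_cogen {X : ModuleCat.{0} A} {n : ℕ} (h : domdimGE A Q X (n+1)) : Cogen Q X := by
  obtain ⟨M, ι, hM, hi, -⟩ := domdim_step h
  exact (cogen_self.inAdd hM).of_inj ι hi

theorem domdim_evSurj {X : ModuleCat.{0} A} {n : ℕ} (h : domdimGE A Q X (n+2)) : EvSurj Q X := by
  obtain ⟨M, ι, hM, hi, hext, hd⟩ := domdim_step h
  exact EvSurj.ker ι _ (exact_mkQ ι) (evSurj_self.inAdd hM) (domdim_cogen hd) hext

theorem domdim_ev (j : ℕ) : ∀ {X : ModuleCat.{0} A} {n : ℕ} (_ : domdimGE A Q X (n+j+3)),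
    EV (Module.End A Q) (X →ₗ[A] Q) Q (j+1) := by
  induction j with
  | zero =>
    intro X n h
    obtain ⟨M, ι, hM, hi, hext, hd⟩ := domdim_step h
    have := hM.hom_proj
    have hx : Function.Exact (hmap Q (LinearMap.range ι).mkQ) (hmap Q ι) :=
      hmap_exact _ _ (exact_mkQ ι) (Submodule.mkQ_surjective _)
    have hinj : Function.Injective (hmap Q (LinearMap.range ι).mkQ) :=
      hmap_inj _ (Submodule.mkQ_surjective _)
    refine ev_one_of_extend (hmap Q (LinearMap.range ι).mkQ) (hmap Q ι) hinj hx hext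
      (ev_proj le_rfl) ?_
    intro φ
    obtain ⟨v, hv⟩ := domdim_evSurj hd φ
    obtain ⟨m, rfl⟩ := Submodule.mkQ_surjective _ v
    refine ⟨LinearMap.applyₗ' (Module.End A Q) m, ?_⟩
    ext f
    exact (hv f).symm
  | succ j ih =>
    intro X n h
    obtain ⟨M, ι, hM, hi, hext, hd⟩ := domdim_step h
    have := hM.hom_proj
    have hx : Function.Exact (hmap Q (LinearMap.range ι).mkQ) (hmap Q ι) :=
      hmap_exact _ _ (exact_mkQ ι) (Submodule.mkQ_surjective _)
    have hinj : Function.Injective (hmap Q (LinearMap.range ι).mkQ) :=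
      hmap_inj _ (Submodule.mkQ_surjective _)
    exact ev_quot (hmap Q (LinearMap.range ι).mkQ) (hmap Q ι) hinj hx hext (ih (n := n) hd)
      (ev_proj (by omega))

end Refl

section Cores
variable {B : Type} [Ring B]

theorem CoresLE.congr {test X X' : ModuleCat.{0} B} {T} {m : ℕ} (h : CoresLE B test T X m)
    (e : X' ≃ₗ[B] X) : CoresLE B test T X' m := by
  obtain ⟨M, ι, d, h1, h2, h3, h4, h5, h6, h7, h8⟩ := h
  refine ⟨M, ι ∘ₗ e.toLinearMap, d, h1, h2, h3.comp e.injective, ?_, h5, ?_, ?_, h8⟩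
  · intro y
    rw [h4 y]
    constructor
    · rintro ⟨x, rfl⟩; exact ⟨e.symm x, by simp⟩
    · rintro ⟨x, rfl⟩; exact ⟨e x, rfl⟩
  · intro f
    obtain ⟨h, hh⟩ := h6 (f ∘ₗ e.symm.toLinearMap)
    refine ⟨h, ?_⟩
    ext x
    have := congrArg (fun g => g (e x)) hh
    simpa using this
  · intro f hf
    refine h7 f ?_
    ext x
    have := congrArg (fun g => g (e.symm x)) hf
    simpa using this

theorem cores_zero {test X : ModuleCat.{0} B} {T : ModuleCat.{0} B → Prop} (h : T X) :
    CoresLE B test T X 0 := by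
  refine ⟨fun j => Nat.casesOn j X (fun _ => zeroMod B), LinearMap.id, fun j => 0, ?_, ?_, ?_, ?_,
    ?_, ?_, ?_, ?_⟩
  · intro j hj
    obtain rfl : j = 0 := by omega
    exact h
  · intro j hj
    obtain ⟨j, rfl⟩ : ∃ i, j = i + 1 := ⟨j - 1, by omega⟩
    exact (inferInstance : Subsingleton PUnit)
  · exact fun _ _ h => h
  · intro y; exact ⟨fun _ => ⟨y, rfl⟩, fun _ => rfl⟩
  · intro j y
    have : Subsingleton (PUnit.{1}) := inferInstance
    exact ⟨fun _ => ⟨0, this.elim _ _⟩, fun _ => rfl⟩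
  · intro f; exact ⟨f, rfl⟩
  · intro f hf
    exact ⟨0, by rw [LinearMap.zero_comp]; exact hf.symm⟩
  · intro j f hf
    refine ⟨0, ?_⟩
    have : Subsingleton (PUnit.{1}) := inferInstance
    refine LinearMap.ext fun x => ?_
    have hx : x = 0 := this.elim _ _
    rw [hx, map_zero, map_zero]

/-- prepend a module to a sequence -/
def consSeq (M₀ : ModuleCat.{0} B) (M : ℕ → ModuleCat.{0} B) : ℕ → ModuleCat.{0} B
  | 0 => M₀
  | (i+1) => M i

/-- prepend a map to a complex -/
def consMap (M₀ : ModuleCat.{0} B) (M : ℕ → ModuleCat.{0} B) (f : M₀ →ₗ[B] M 0)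
    (d : ∀ j, M j →ₗ[B] M (j+1)) : ∀ j, consSeq M₀ M j →ₗ[B] consSeq M₀ M (j+1)
  | 0 => f
  | (i+1) => d i

theorem cores_succ {test X X' M₀ : ModuleCat.{0} B} {T : ModuleCat.{0} B → Prop} {m : ℕ}
    (ι₀ : X →ₗ[B] M₀) (π : M₀ →ₗ[B] X') (hT : T M₀) (hι : Function.Injective ι₀)
    (hx : Function.Exact ι₀ π) (hπ : Function.Surjective π)
    (hext : ∀ f : X →ₗ[B] test, ∃ h : M₀ →ₗ[B] test, h ∘ₗ ι₀ = f)
    (h : CoresLE B test T X' m) : CoresLE B test T X (m+1) := by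
  obtain ⟨M, ι, d, h1, h2, h3, h4, h5, h6, h7, h8⟩ := h
  let M' : ℕ → ModuleCat.{0} B := consSeq M₀ M
  let d' := consMap M₀ M (ι ∘ₗ π : M₀ →ₗ[B] M 0) d
  have hfac : ∀ f : M₀ →ₗ[B] test, f ∘ₗ ι₀ = 0 → ∃ g : X' →ₗ[B] test, g ∘ₗ π = f := by
    intro f hf
    exact exists_factor ι₀ π hx hπ f hf
  refine ⟨M', ι₀, d', ?_, ?_, hι, ?_, ?_, hext, ?_, ?_⟩
  · intro j hj
    cases j with
    | zero => exact hT
    | succ i => exact h1 i (by omega)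
  · intro j hj
    cases j with
    | zero => omega
    | succ i => exact h2 i (by omega)
  · intro y
    refine Iff.trans ?_ (hx y)
    have : ∀ z, ι z = 0 ↔ z = 0 := fun z => by rw [← map_zero ι, h3.eq_iff]
    exact this (π y)
  · intro j
    cases j with
    | zero =>
      intro y
      refine (h4 y).trans ?_
      constructor
      · rintro ⟨x, rfl⟩
        obtain ⟨z, rfl⟩ := hπ x
        exact ⟨z, rfl⟩
      · rintro ⟨x, rfl⟩; exact ⟨π x, rfl⟩
    | succ i => exact h5 i
  · intro f hf
    obtain ⟨g, hg⟩ := hfac f hf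
    obtain ⟨h, hh⟩ := h6 g
    refine ⟨h, ?_⟩
    rw [← hg, ← hh]; rfl
  · intro j
    cases j with
    | zero =>
      intro f hf
      refine h7 f ?_
      ext x
      obtain ⟨z, rfl⟩ := hπ x
      exact congrArg (fun g => g z) hf
    | succ i => exact h8 i

end Cores

end Paper
end Part3

noncomputable section Part4
namespace Paper

theorem exists_free {A : Type} [Ring A] (L : Type) [AddCommGroup L] [Module A L]
    [Module.Finite A L] : ∃ (r : ℕ) (p : (Fin r → A) →ₗ[A] L), Function.Surjective p :=
  Module.Finite.exists_fin' A L

theorem final_cores {A : Type} [Ring A] [IsNoetherianRing A] {Q : ModuleCat.{0} A}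
    (hA1 : Cogen Q A) (hA2 : EvSurj Q A) (l : ℕ) :
    ∀ (L : Type) [AddCommGroup L] [Module A L] [Module.Finite A L]
      (_ : ∀ (N : Type) [AddCommGroup N] [Module A N] [Module.Finite A N] (j : ℕ), l < j →
        EV A L N j)
      (_ : ∀ j, 1 ≤ j → EV A L Q j) (_ : Cogen Q L) (_ : EvSurj Q L),
      CoresLE (Module.End A Q) (ModuleCat.of _ Q) (InAdd (Module.End A Q) (ModuleCat.of _ Q))
        (ModuleCat.of _ (L →ₗ[A] Q)) l := by
  induction l with
  | zero =>
    intro L _ _ _ h1 h2 h3 h4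
    obtain ⟨r, p, hp⟩ := exists_free (A := A) L
    obtain ⟨s, hs⟩ := lift_of_ev (LinearMap.ker p).subtype p (Submodule.subtype_injective _)
      (exact_ker p) hp (h1 _ 1 (by omega)) (LinearMap.id : L →ₗ[A] L)
    have : Module.Projective A L := Module.Projective.of_split s p hs
    exact cores_zero (InAdd.hom_free (X := ModuleCat.of A L) (inAdd_of_proj (ModuleCat.of A L)))
  | succ l ih =>
    intro L _ _ _ h1 h2 h3 h4
    obtain ⟨r, p, hp⟩ := exists_free (A := A) L
    have hadd : InAdd A (ModuleCat.of A A) (ModuleCat.of A (Fin r → A)) :=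
      inAdd_of_proj (ModuleCat.of A (Fin r → A))
    have c1 : Cogen Q (Fin r → A) := Cogen.inAdd (V := ModuleCat.of A A) hA1 hadd
    have c2 : EvSurj Q (Fin r → A) := EvSurj.inAdd (V := ModuleCat.of A A) hA2 hadd
    let f := (LinearMap.ker p).subtype
    have hf : Function.Injective f := Submodule.subtype_injective _
    have hfp : Function.Exact f p := exact_ker p
    have hext : ∀ u : LinearMap.ker p →ₗ[A] Q, ∃ v : (Fin r → A) →ₗ[A] Q, v ∘ₗ f = u :=
      fun u => extend_of_ev f p hf hfp hp (h2 1 le_rfl) u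
    refine cores_succ (M₀ := ModuleCat.of _ ((Fin r → A) →ₗ[A] Q))
      (X' := ModuleCat.of _ (LinearMap.ker p →ₗ[A] Q)) (hmap Q p) (hmap Q f) hadd.hom_free
      (hmap_inj p hp) (hmap_exact f p hfp hp) hext ?_ (ih (LinearMap.ker p) ?_ ?_ ?_ ?_)
    · intro φ
      obtain ⟨v, hv⟩ := h4 φ
      obtain ⟨x, rfl⟩ := hp v
      refine ⟨LinearMap.applyₗ' (Module.End A Q) x, ?_⟩
      ext g
      exact (hv g).symm
    · intro N _ _ _ j hj
      exact ev_sub f p hf hfp hp (ev_proj (by omega)) (h1 N (j+1) (by omega))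
    · intro j hj
      exact ev_sub f p hf hfp hp (ev_proj hj) (h2 (j+1) (by omega))
    · exact c1.of_inj f hf
    · exact EvSurj.ker f p hfp c2 h3 hext

end Paper
end Part4

noncomputable section Part5
namespace Paper
open MulOpposite

section KLin
variable {k : Type} [Field k]

theorem k_factor {V W U : Type} [AddCommGroup V] [Module k V] [AddCommGroup W] [Module k W]
    [AddCommGroup U] [Module k U] (f : V →ₗ[k] W) (g : W →ₗ[k] U) (hfg : Function.Exact f g)
    (φ : W →ₗ[k] k) (hφ : φ ∘ₗ f = 0) : ∃ ψ : U →ₗ[k] k, ψ ∘ₗ g = φ := by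
  have h1 : φ ∈ LinearMap.range g.dualMap := by
    rw [LinearMap.range_dualMap_eq_dualAnnihilator_ker, Submodule.mem_dualAnnihilator]
    intro w hw
    obtain ⟨v, rfl⟩ := (hfg w).1 hw
    exact congrArg (fun h => h v) hφ
  obtain ⟨ψ, hψ⟩ := h1
  exact ⟨ψ, hψ⟩

theorem k_extend {W U : Type} [AddCommGroup W] [Module k W]
    [AddCommGroup U] [Module k U] (g : W →ₗ[k] U) (hg : Function.Injective g)
    (φ : W →ₗ[k] k) : ∃ ψ : U →ₗ[k] k, ψ ∘ₗ g = φ := by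
  refine k_factor (0 : W →ₗ[k] W) g ?_ φ (by simp)
  intro w
  rw [← map_zero g, hg.eq_iff]
  constructor
  · rintro rfl; exact ⟨0, rfl⟩
  · rintro ⟨x, rfl⟩; rfl

end KLin

section Dual
variable (k : Type) [Field k] {B : Type} [Ring B] [Algebra k B]

/-- `B`-linear maps are `k`-linear -/
def toK {X Y : ModuleCat.{0} B} (f : X →ₗ[B] Y) : X →ₗ[k] Y := f.restrictScalars k

@[simp] theorem toK_apply {X Y : ModuleCat.{0} B} (f : X →ₗ[B] Y) (x : X) : toK k f x = f x := rfl

theorem kmod_smul (X : ModuleCat.{0} B) (c : k) (x : X) : c • x = (algebraMap k B c) • x := rfl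

/-- dual of a map of right modules -/
def dualU {M N : ModuleCat.{0} Bᵐᵒᵖ} (f : M →ₗ[Bᵐᵒᵖ] N) : Dunop k B N →ₗ[B] Dunop k B M where
  toFun φ := (show N →ₗ[k] k from φ) ∘ₗ toK k f
  map_add' _ _ := rfl
  map_smul' b φ := by
    refine LinearMap.ext fun x => ?_
    change (show N →ₗ[k] k from φ) (op b • f x) = (show N →ₗ[k] k from φ) (f (op b • x))
    rw [f.map_smul]

/-- dual of a map of left modules -/
def dualO {M N : ModuleCat.{0} B} (f : M →ₗ[B] N) : Dop k B N →ₗ[Bᵐᵒᵖ] Dop k B M where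
  toFun φ := (show N →ₗ[k] k from φ) ∘ₗ toK k f
  map_add' _ _ := rfl
  map_smul' b φ := by
    refine LinearMap.ext fun x => ?_
    change (show N →ₗ[k] k from φ) (b.unop • f x) = (show N →ₗ[k] k from φ) (f (b.unop • x))
    rw [f.map_smul]

theorem dualU_exact {M N L : ModuleCat.{0} Bᵐᵒᵖ} (f : M →ₗ[Bᵐᵒᵖ] N) (g : N →ₗ[Bᵐᵒᵖ] L)
    (h : Function.Exact f g) : Function.Exact (dualU k g) (dualU k f) := by
  intro φ
  constructor
  · intro hφ
    obtain ⟨ψ, hψ⟩ := k_factor (toK k f) (toK k g) h φ hφ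
    exact ⟨ψ, hψ⟩
  · rintro ⟨ψ, rfl⟩
    refine LinearMap.ext fun x => ?_
    change (show L →ₗ[k] k from ψ) (g (f x)) = 0
    have : g (f x) = 0 := (h _).2 ⟨x, rfl⟩
    rw [this, map_zero]

theorem dualU_inj {M N : ModuleCat.{0} Bᵐᵒᵖ} (f : M →ₗ[Bᵐᵒᵖ] N)
    (h : Function.Surjective f) : Function.Injective (dualU k f) := by
  intro φ ψ hφ
  refine LinearMap.ext fun x => ?_
  obtain ⟨y, rfl⟩ := h x
  exact congrArg (fun g : M →ₗ[k] k => g y) hφ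

theorem dualU_surj {M N : ModuleCat.{0} Bᵐᵒᵖ} (f : M →ₗ[Bᵐᵒᵖ] N)
    (h : Function.Injective f) : Function.Surjective (dualU k f) := by
  intro φ
  obtain ⟨ψ, hψ⟩ := k_extend (toK k f) h φ
  exact ⟨ψ, hψ⟩

theorem dualO_surj {M N : ModuleCat.{0} B} (f : M →ₗ[B] N)
    (h : Function.Injective f) : Function.Surjective (dualO k f) := by
  intro φ
  obtain ⟨ψ, hψ⟩ := k_extend (toK k f) h φ
  exact ⟨ψ, hψ⟩

theorem Dop_smul (X : ModuleCat.{0} B) (c : k) (φ : Dop k B X) :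
    c • φ = (c • (show X →ₗ[k] k from φ) : X →ₗ[k] k) := by
  refine LinearMap.ext fun x => ?_
  change (show X →ₗ[k] k from φ) (c • x) = c • (show X →ₗ[k] k from φ) x
  rw [map_smul]

theorem Dunop_smul (X : ModuleCat.{0} Bᵐᵒᵖ) (c : k) (φ : Dunop k B X) :
    c • φ = (c • (show X →ₗ[k] k from φ) : X →ₗ[k] k) := by
  refine LinearMap.ext fun x => ?_
  change (show X →ₗ[k] k from φ) (c • x) = c • (show X →ₗ[k] k from φ) x
  rw [map_smul]

/-- identification of `k`-structures -/
def DopK (X : ModuleCat.{0} B) : Dop k B X ≃ₗ[k] (X →ₗ[k] k) where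
  toFun φ := φ
  invFun φ := φ
  map_add' _ _ := rfl
  map_smul' c φ := Dop_smul k X c φ
  left_inv _ := rfl
  right_inv _ := rfl

/-- identification of `k`-structures -/
def DunopK (X : ModuleCat.{0} Bᵐᵒᵖ) : Dunop k B X ≃ₗ[k] (X →ₗ[k] k) where
  toFun φ := φ
  invFun φ := φ
  map_add' _ _ := rfl
  map_smul' c φ := Dunop_smul k X c φ
  left_inv _ := rfl
  right_inv _ := rfl

theorem fin_k [FiniteDimensional k B] (X : ModuleCat.{0} B) [Module.Finite B X] :
    Module.Finite k X := Module.Finite.trans B X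

theorem fin_B (X : ModuleCat.{0} B) [Module.Finite k X] :
    Module.Finite B X := Module.Finite.of_restrictScalars_finite k B X

theorem Dop_fin (X : ModuleCat.{0} B) [Module.Finite k X] : Module.Finite k (Dop k B X) :=
  Module.Finite.equiv (DopK k X).symm

theorem Dunop_fin (X : ModuleCat.{0} Bᵐᵒᵖ) [Module.Finite k X] : Module.Finite k (Dunop k B X) :=
  Module.Finite.equiv (DunopK k X).symm

/-- double dual -/
theorem bidual (Z : ModuleCat.{0} B) [Module.Finite k Z] :
    Nonempty (Z ≃ₗ[B] Dunop k B (Dop k B Z)) := by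
  let f : Z →ₗ[B] Dunop k B (Dop k B Z) :=
    { toFun := fun z => (Module.Dual.eval k Z z) ∘ₗ (DopK k Z).toLinearMap
      map_add' := fun x y => by
        refine LinearMap.ext fun φ => ?_
        exact map_add (DopK k Z φ) x y
      map_smul' := fun b x => rfl }
  refine ⟨LinearEquiv.ofBijective f ⟨?_, ?_⟩⟩
  · rw [injective_iff_map_eq_zero]
    intro z hz
    refine (Module.forall_dual_apply_eq_zero_iff k z).1 fun φ => ?_
    exact congrArg (fun h : Dop k B Z →ₗ[k] k => h φ) hz
  · intro w
    let w' : Module.Dual k (Module.Dual k Z) :=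
      (show Dop k B Z →ₗ[k] k from w) ∘ₗ (DopK k Z).symm.toLinearMap
    refine ⟨(Module.evalEquiv k Z).symm w', ?_⟩
    refine LinearMap.ext fun φ => ?_
    change (DopK k Z φ) ((Module.evalEquiv k Z).symm w') = _
    rw [Module.apply_evalEquiv_symm_apply]
    rfl

theorem inj_dual_aux (P : ModuleCat.{0} Bᵐᵒᵖ) [Module.Projective Bᵐᵒᵖ P]
    (X' Y' : ModuleCat.{0} B) (f' : X' →ₗ[B] Y') (hf : Function.Injective f')
    (g' : X' →ₗ[B] Dunop k B P) : ∃ h : Y' →ₗ[B] Dunop k B P, ∀ x, h (f' x) = g' x := by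
  let gt : P →ₗ[Bᵐᵒᵖ] Dop k B X' :=
    { toFun := fun p => (Module.Dual.eval k P p) ∘ₗ (DunopK k P).toLinearMap ∘ₗ toK k g'
      map_add' := fun x y => by
        refine LinearMap.ext fun φ => ?_
        exact map_add (DunopK k P (g' φ)) x y
      map_smul' := fun b x => by
        refine LinearMap.ext fun φ => ?_
        change (DunopK k P (g' φ)) (b • x) = (DunopK k P (g' (b.unop • φ))) x
        rw [g'.map_smul]; rfl }
  obtain ⟨h, hh⟩ := Module.projective_lifting_property (dualO k f') gt (dualO_surj k f' hf)
  let ht : Y' →ₗ[B] Dunop k B P :=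
    { toFun := fun y => (Module.Dual.eval k Y' y) ∘ₗ (DopK k Y').toLinearMap ∘ₗ toK k h
      map_add' := fun x y => by
        refine LinearMap.ext fun φ => ?_
        exact map_add (DopK k Y' (h φ)) x y
      map_smul' := fun b x => by
        refine LinearMap.ext fun φ => ?_
        change (DopK k Y' (h φ)) (b • x) = (DopK k Y' (h (op b • φ))) x
        rw [h.map_smul]; rfl }
  refine ⟨ht, fun x => ?_⟩
  refine LinearMap.ext fun p => ?_
  exact congrArg (fun u : P →ₗ[Bᵐᵒᵖ] Dop k B X' => (DopK k X' (u p)) x) hh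

/-- duals of projectives are injective -/
theorem inj_dual (P : ModuleCat.{0} Bᵐᵒᵖ) [Module.Projective Bᵐᵒᵖ P] :
    Module.Injective B (Dunop k B P) :=
  ⟨fun X Y _ _ _ _ f hf g => inj_dual_aux k P (ModuleCat.of B X) (ModuleCat.of B Y) f hf g⟩

theorem exists_pres {R : Type} [Ring R] [IsNoetherianRing R] (M : ModuleCat.{0} R)
    [Module.Finite R M] : ∃ (F K : ModuleCat.{0} R) (i : K →ₗ[R] F) (p : F →ₗ[R] M),
      Module.Finite R F ∧ Module.Finite R K ∧ Module.Projective R F ∧ Function.Injective i ∧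
      Function.Exact i p ∧ Function.Surjective p := by
  obtain ⟨r, p, hp⟩ := exists_free (A := R) M
  exact ⟨ModuleCat.of R (Fin r → R), ModuleCat.of R (LinearMap.ker p), (LinearMap.ker p).subtype, p,
    (inferInstance : Module.Finite R (Fin r → R)),
    (inferInstance : Module.Finite R (LinearMap.ker p)),
    (inferInstance : Module.Projective R (Fin r → R)), Submodule.subtype_injective _,
    exact_ker p, hp⟩

/-- fullness of the duality -/
theorem dualU_full {M N : ModuleCat.{0} Bᵐᵒᵖ} [Module.Finite k N]
    (u : Dunop k B N →ₗ[B] Dunop k B M) : ∃ f : M →ₗ[Bᵐᵒᵖ] N, dualU k f = u := by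
  let w : M → Module.Dual k (Module.Dual k N) := fun m =>
    (Module.Dual.eval k M m) ∘ₗ (DunopK k M).toLinearMap ∘ₗ toK k u ∘ₗ (DunopK k N).symm.toLinearMap
  have hw : ∀ m (φ : N →ₗ[k] k), φ ((Module.evalEquiv k N).symm (w m)) =
      DunopK k M (u ((DunopK k N).symm φ)) m := by
    intro m φ
    rw [Module.apply_evalEquiv_symm_apply]; rfl
  have hsep : ∀ x y : N, (∀ φ : N →ₗ[k] k, φ x = φ y) → x = y := by
    intro x y h
    rw [← sub_eq_zero]
    refine (Module.forall_dual_apply_eq_zero_iff k _).1 fun φ => ?_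
    rw [map_sub, h, sub_self]
  refine ⟨{ toFun := fun m => (Module.evalEquiv k N).symm (w m), map_add' := ?_, map_smul' := ?_ }, ?_⟩
  · intro x y
    refine hsep _ _ fun φ => ?_
    rw [map_add, hw, hw, hw, map_add]
  · intro b x
    refine hsep _ _ fun φ => ?_
    rw [hw, RingHom.id_apply]
    let φ' : Dunop k B N := φ
    change _ = (DunopK k N (b.unop • φ')) ((Module.evalEquiv k N).symm (w x))
    rw [hw]
    change _ = DunopK k M (u (b.unop • φ')) x
    rw [u.map_smul]; rfl
  · refine LinearMap.ext fun φ => LinearMap.ext fun m => ?_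
    exact hw m φ

theorem ev_dual [FiniteDimensional k B] {N : ModuleCat.{0} Bᵐᵒᵖ} [Module.Finite k N] (j : ℕ) :
    ∀ {M : ModuleCat.{0} Bᵐᵒᵖ} [Module.Finite k M], EV Bᵐᵒᵖ M N (j+1) →
      EV B (Dunop k B N) (Dunop k B M) (j+1) := by
  have hB : FiniteDimensional k Bᵐᵒᵖ := Module.Finite.equiv (opLinearEquiv k)
  have hNoeth : IsNoetherianRing Bᵐᵒᵖ := IsNoetherianRing.of_finite k Bᵐᵒᵖ
  induction j with
  | zero =>
    intro M hM h
    have := fin_B k M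
    obtain ⟨F, K, i, p, h1, h2, h3, h4, h5, h6⟩ := exists_pres M
    have := fin_k k F
    have := fin_k k K
    have := inj_dual k F
    refine ev_one_of_lift (dualU k p) (dualU k i) (dualU_inj k p h6) (dualU_exact k i p h5)
      (dualU_surj k i h4) (ev_inj le_rfl) ?_
    intro u
    obtain ⟨f, rfl⟩ := dualU_full k u
    obtain ⟨v, hv⟩ := extend_of_ev i p h4 h5 h6 h f
    refine ⟨dualU k v, ?_⟩
    rw [← hv]; rfl
  | succ j ih =>
    intro M hM h
    have := fin_B k M
    obtain ⟨F, K, i, p, h1, h2, h3, h4, h5, h6⟩ := exists_pres M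
    have := fin_k k F
    have := fin_k k K
    have := inj_dual k F
    exact ev_csub (dualU k p) (dualU k i) (dualU_inj k p h6) (dualU_exact k i p h5)
      (dualU_surj k i h4) (ih (ev_sub i p h4 h5 h6 (ev_proj (by omega)) h)) (ev_inj (by omega))

end Dual
end Paper
end Part5

noncomputable section Part6
namespace Paper
open MulOpposite

section Functors
variable (k : Type) [Field k] {A : Type} [Ring A] [Algebra k A] (Q : ModuleCat.{0} A)

/-- `Hom_E(Q,Z)` as right `A`-module -/
instance fmMod (Z : ModuleCat.{0} (Module.End A Q)) : Module Aᵐᵒᵖ (Q →ₗ[Module.End A Q] Z) where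
  smul a g := g ∘ₗ (toEndE A Q a.unop)
  one_smul g := by
    ext q
    change g ((1 : A) • q) = g q
    rw [one_smul]
  mul_smul a b g := by
    ext q
    change g ((b.unop * a.unop) • q) = g (b.unop • a.unop • q)
    rw [mul_smul]
  smul_zero a := rfl
  smul_add a g h := rfl
  add_smul a b g := by
    ext q
    change g ((a.unop + b.unop) • q) = g (a.unop • q) + g (b.unop • q)
    rw [add_smul, map_add]
  zero_smul g := by
    ext q
    change g ((0 : A) • q) = 0
    rw [zero_smul, map_zero]

/-- the functor `Hom_E(Q,-)` -/
def Fm (Z : ModuleCat.{0} (Module.End A Q)) : ModuleCat.{0} Aᵐᵒᵖ :=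
  ModuleCat.of Aᵐᵒᵖ (Q →ₗ[Module.End A Q] Z)

variable {Q}

/-- view as a map -/
def fmFn {Z : ModuleCat.{0} (Module.End A Q)} (g : Fm Q Z) : Q →ₗ[Module.End A Q] Z := g

theorem fm_ext {Z : ModuleCat.{0} (Module.End A Q)} {g h : Fm Q Z} (H : ∀ q, (fmFn g) q = (fmFn h) q) :
    g = h := LinearMap.ext H

/-- functoriality -/
def fmap {Z Z' : ModuleCat.{0} (Module.End A Q)} (u : Z →ₗ[Module.End A Q] Z') :
    Fm Q Z →ₗ[Aᵐᵒᵖ] Fm Q Z' where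
  toFun g := u ∘ₗ (fmFn g)
  map_add' _ _ := LinearMap.ext fun _ => map_add u _ _
  map_smul' _ _ := rfl

theorem fmap_inj {Z Z' : ModuleCat.{0} (Module.End A Q)} (u : Z →ₗ[Module.End A Q] Z')
    (hu : Function.Injective u) : Function.Injective (fmap u) := by
  intro g h hgh
  refine fm_ext fun q => hu ?_
  exact congrArg (fun v : Q →ₗ[Module.End A Q] Z' => v q) hgh

theorem fmap_exact {Z Z' Z'' : ModuleCat.{0} (Module.End A Q)} (u : Z →ₗ[Module.End A Q] Z')
    (v : Z' →ₗ[Module.End A Q] Z'') (hu : Function.Injective u) (huv : Function.Exact u v) :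
    Function.Exact (fmap u) (fmap v) := by
  intro g
  constructor
  · intro hg
    have h1 : ∀ q, ∃ z, u z = (fmFn g) q := by
      intro q
      refine (huv _).1 ?_
      exact congrArg (fun v : Q →ₗ[Module.End A Q] Z'' => v q) hg
    choose z hz using h1
    refine ⟨({ toFun := z, map_add' := ?_, map_smul' := ?_ } : Q →ₗ[Module.End A Q] Z), ?_⟩
    · intro x y; apply hu; rw [map_add, hz, hz, hz, map_add]
    · intro e x; apply hu; rw [map_smul, hz, hz, map_smul]; rfl
    · exact fm_ext fun q => hz q
  · rintro ⟨h, rfl⟩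
    refine fm_ext fun q => ?_
    exact (huv _).2 ⟨(fmFn h) q, rfl⟩

/-- the contravariant functor `D Hom_E(Q,-)` -/
def Gm (Z : ModuleCat.{0} (Module.End A Q)) : ModuleCat.{0} A := Dunop k A (Fm Q Z)

/-- functoriality -/
def gmap {Z Z' : ModuleCat.{0} (Module.End A Q)} (u : Z →ₗ[Module.End A Q] Z') :
    Gm k Z' →ₗ[A] Gm k Z := dualU k (fmap u)

theorem gmap_comp {Z Z' Z'' : ModuleCat.{0} (Module.End A Q)} (u : Z →ₗ[Module.End A Q] Z')
    (v : Z' →ₗ[Module.End A Q] Z'') : gmap k (v ∘ₗ u) = gmap k u ∘ₗ gmap k v := rfl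

theorem gmap_id {Z : ModuleCat.{0} (Module.End A Q)} :
    gmap k (LinearMap.id : Z →ₗ[Module.End A Q] Z) = LinearMap.id := rfl

theorem gmap_surj {Z Z' : ModuleCat.{0} (Module.End A Q)} (u : Z →ₗ[Module.End A Q] Z')
    (hu : Function.Injective u) : Function.Surjective (gmap k u) :=
  dualU_surj k _ (fmap_inj u hu)

theorem gmap_exact {Z Z' Z'' : ModuleCat.{0} (Module.End A Q)} (u : Z →ₗ[Module.End A Q] Z')
    (v : Z' →ₗ[Module.End A Q] Z'') (hu : Function.Injective u) (huv : Function.Exact u v) :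
    Function.Exact (gmap k v) (gmap k u) :=
  dualU_exact k _ _ (fmap_exact u v hu huv)

theorem gmap_inj {Z Z' : ModuleCat.{0} (Module.End A Q)} (u : Z →ₗ[Module.End A Q] Z')
    (hu : ∀ g : Q →ₗ[Module.End A Q] Z', ∃ h : Q →ₗ[Module.End A Q] Z, u ∘ₗ h = g) :
    Function.Injective (gmap k u) :=
  dualU_inj k _ hu

theorem fm_k_smul {Z : ModuleCat.{0} (Module.End A Q)} (c : k) (g : Fm Q Z) (q : Q) :
    fmFn (c • g) q = c • (fmFn g) q := by
  have h1 : fmFn (c • g) q = (fmFn g) ((algebraMap k (Module.End A Q) c) • q) := rfl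
  rw [h1, map_smul]; rfl

section FD
variable [FiniteDimensional k A] [Module.Finite A Q]

theorem fdQ : Module.Finite k Q := fin_k k Q

theorem fdE : FiniteDimensional k (Module.End A Q) := by
  have := fdQ k (Q := Q)
  exact Module.Finite.of_injective (LinearMap.restrictScalarsₗ k A Q Q k)
    (LinearMap.restrictScalars_injective k)

theorem finEQ (k : Type) [Field k] {A : Type} [Ring A] [Algebra k A] {Q : ModuleCat.{0} A}
    [FiniteDimensional k A] [Module.Finite A Q] : Module.Finite (Module.End A Q) Q := by
  have := fdQ k (Q := Q)
  exact Module.Finite.of_restrictScalars_finite k (Module.End A Q) Q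

theorem fm_fin (Z : ModuleCat.{0} (Module.End A Q)) [Module.Finite (Module.End A Q) Z] :
    Module.Finite k (Fm Q Z) := by
  have := fdE k (Q := Q)
  have := finEQ k (Q := Q)
  have := fin_k k Z
  obtain ⟨r, q, hq⟩ := Module.Finite.exists_fin (R := Module.End A Q) (M := Q)
  let f : Fm Q Z →ₗ[k] (Fin r → Z) :=
    { toFun := fun g i => (fmFn g) (q i)
      map_add' := fun _ _ => rfl
      map_smul' := fun c g => by
        ext i
        exact fm_k_smul k c g (q i) }
  refine Module.Finite.of_injective f ?_
  intro g h hgh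
  refine LinearMap.ext_on_range (v := q) hq fun i => ?_
  exact congrFun hgh i

theorem gm_fin (Z : ModuleCat.{0} (Module.End A Q)) [Module.Finite (Module.End A Q) Z] :
    Module.Finite A (Gm k Z) := by
  have := fm_fin k Z
  have := Dunop_fin k (Fm Q Z)
  exact fin_B k (Dunop k A (Fm Q Z))

end FD

/-- `Q` as an `E`-module -/
def QE (Q : ModuleCat.{0} A) : ModuleCat.{0} (Module.End A Q) := ModuleCat.of _ Q

/-- dual of an isomorphism -/
def dualU_equiv {M N : ModuleCat.{0} Aᵐᵒᵖ} (e : M ≃ₗ[Aᵐᵒᵖ] N) : Dunop k A N ≃ₗ[A] Dunop k A M :=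
  LinearEquiv.ofLinearMap (dualU k e.toLinearMap) (dualU k e.symm.toLinearMap)
    (by
      refine LinearMap.ext fun φ => LinearMap.ext fun x => ?_
      change (show M →ₗ[k] k from φ) (e.symm (e x)) = _
      rw [e.symm_apply_apply]; rfl)
    (by
      refine LinearMap.ext fun φ => LinearMap.ext fun x => ?_
      change (show N →ₗ[k] k from φ) (e (e.symm x)) = _
      rw [e.apply_symm_apply]; rfl)

theorem fm_QE (hA1 : Cogen Q A) (hA2 : EvSurj Q A) :
    Nonempty (ModuleCat.of Aᵐᵒᵖ Aᵐᵒᵖ ≃ₗ[Aᵐᵒᵖ] Fm Q (QE Q)) := by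
  let f : Aᵐᵒᵖ →ₗ[Aᵐᵒᵖ] Fm Q (QE Q) :=
    { toFun := fun a => toEndE A Q a.unop
      map_add' := fun a b => map_add (toEndE A Q) a.unop b.unop
      map_smul' := fun a b => map_mul (toEndE A Q) b.unop a.unop }
  refine ⟨LinearEquiv.ofBijective f ⟨?_, ?_⟩⟩
  · rw [injective_iff_map_eq_zero]
    intro a ha
    rw [← unop_eq_zero_iff]
    refine hA1 _ fun g => ?_
    have : g a.unop = a.unop • g 1 := by rw [← map_smul, smul_eq_mul, mul_one]
    rw [this]
    exact congrArg (fun v : Q →ₗ[Module.End A Q] Q => v (g 1)) ha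
  · intro g
    let eq := LinearMap.ringLmapEquivSelf A (Module.End A Q) Q
    obtain ⟨a, ha⟩ := hA2 ((show Q →ₗ[Module.End A Q] Q from g) ∘ₗ eq.toLinearMap)
    refine ⟨op a, ?_⟩
    refine fm_ext fun q => ?_
    have := ha (eq.symm q)
    rw [LinearMap.comp_apply] at this
    change (fmFn g) (eq (eq.symm q)) = _ at this
    rw [eq.apply_symm_apply] at this
    rw [this]
    rfl

end Functors

end Paper
end Part6

noncomputable section Part7
namespace Paper
open MulOpposite

section Psi
variable (k : Type) [Field k] {A : Type} [Ring A] [Algebra k A] {Q : ModuleCat.{0} A}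
variable {P : ModuleCat.{0} (Module.End A Q)ᵐᵒᵖ}

theorem gm_ext {Z : ModuleCat.{0} (Module.End A Q)} {x y : Gm k Z}
    (h : ∀ g : Fm Q Z, (show Fm Q Z →ₗ[k] k from x) g = (show Fm Q Z →ₗ[k] k from y) g) : x = y :=
  LinearMap.ext h

/-- value of an element of `Hom_E(Q, DP)` -/
def fv (g : Fm Q (Dunop k (Module.End A Q) P)) (q : Q) (p : P) : k :=
  (show P →ₗ[k] k from fmFn g q) p

theorem fv_e (g : Fm Q (Dunop k (Module.End A Q) P)) (e : Module.End A Q) (q : Q) (p : P) :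
    fv k g (e q) p = fv k g q (op e • p) := by
  have h := (fmFn g).map_smul e q
  exact congrArg (fun u : P →ₗ[k] k => u p) h

theorem fm_smul_fn {Z : ModuleCat.{0} (Module.End A Q)} (a : A) (g : Fm Q Z) (q : Q) :
    fmFn (op a • g) q = fmFn g (a • q) := rfl

theorem fv_k (c : k) (g : Fm Q (Dunop k (Module.End A Q) P)) (q : Q) (p : P) :
    fv k (c • g) q p = c * fv k g q p := by
  have h := fm_k_smul k c g q
  have h2 := Dunop_smul k P c (fmFn g q)
  exact congrArg (fun u : P →ₗ[k] k => u p) (h.trans h2)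

/-- the elements `p ⊗ q` -/
def ww (p : P) : Q →ₗ[A] Gm k (Dunop k (Module.End A Q) P) where
  toFun q :=
    ({ toFun := fun g => fv k g q p
       map_add' := fun _ _ => rfl
       map_smul' := fun c g => fv_k k c g q p } :
      Fm Q (Dunop k (Module.End A Q) P) →ₗ[k] k)
  map_add' q q' := gm_ext k fun g =>
    congrArg (fun u : P →ₗ[k] k => u p) (map_add (fmFn g) q q')
  map_smul' a q := rfl

theorem ww_e (e : Module.End A Q) (p : P) : ww k (op e • p) = ww k p ∘ₗ e := by
  refine LinearMap.ext fun q => gm_ext k fun g => ?_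
  exact (fv_e k g e q p).symm

theorem ww_add (p p' : P) : ww k (p + p') = ww k p + ww k p' := by
  refine LinearMap.ext fun q => gm_ext k fun g => ?_
  exact map_add (show P →ₗ[k] k from fmFn g q) p p'

/-- the map `Hom_A(G(DP),Q) → Hom_E(P,E)` -/
def Phi (h : Gm k (Dunop k (Module.End A Q) P) →ₗ[A] Q) :
    P →ₗ[(Module.End A Q)ᵐᵒᵖ] (Module.End A Q)ᵐᵒᵖ where
  toFun p := op (h ∘ₗ ww k p)
  map_add' p p' := by
    rw [ww_add, LinearMap.comp_add, op_add]
  map_smul' e p := by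
    have := ww_e k e.unop p
    rw [op_unop] at this
    rw [this]; rfl

theorem Phi_nat {P' : ModuleCat.{0} (Module.End A Q)ᵐᵒᵖ} (f : P →ₗ[(Module.End A Q)ᵐᵒᵖ] P')
    (h : Gm k (Dunop k (Module.End A Q) P') →ₗ[A] Q) :
    Phi k (h ∘ₗ gmap k (dualU k f)) = Phi k h ∘ₗ f := rfl

theorem Phi_smul (e : Module.End A Q) (h : Gm k (Dunop k (Module.End A Q) P) →ₗ[A] Q) :
    Phi k (e • h) = op (op e) • Phi k h := rfl

theorem Phi_add (h h' : Gm k (Dunop k (Module.End A Q) P) →ₗ[A] Q) :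
    Phi k (h + h') = Phi k h + Phi k h' := rfl

/-- auxiliary functionals -/
def TT (φ : P →ₗ[(Module.End A Q)ᵐᵒᵖ] (Module.End A Q)ᵐᵒᵖ) (ξ : Q →ₗ[k] k) :
    Fm Q (Dunop k (Module.End A Q) P) :=
  ({ toFun := fun q => ({ toFun := fun p => ξ ((φ p).unop q)
                          map_add' := fun p p' => by
                            rw [map_add, unop_add, LinearMap.add_apply, map_add]
                          map_smul' := fun c p => by
                            rw [kmod_smul, φ.map_smul, RingHom.id_apply, ← ξ.map_smul]
                            exact congrArg ξ ((φ p).unop.map_smul (algebraMap k A c) q) } : P →ₗ[k] k)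
     map_add' := fun q q' => LinearMap.ext fun p => by
       change ξ ((φ p).unop (q + q')) = ξ ((φ p).unop q) + ξ ((φ p).unop q')
       rw [map_add, map_add]
     map_smul' := fun e q => LinearMap.ext fun p => by
       change ξ ((φ p).unop (e q)) = ξ ((φ (op e • p)).unop q)
       rw [map_smul]; rfl } : Q →ₗ[Module.End A Q] Dunop k (Module.End A Q) P)

theorem fv_TT (φ : P →ₗ[(Module.End A Q)ᵐᵒᵖ] (Module.End A Q)ᵐᵒᵖ) (ξ : Q →ₗ[k] k) (q : Q) (p : P) :
    fv k (TT k φ ξ) q p = ξ ((φ p).unop q) := rfl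

theorem fv_ext {g h : Fm Q (Dunop k (Module.End A Q) P)} (H : ∀ q p, fv k g q p = fv k h q p) :
    g = h := fm_ext fun q => LinearMap.ext fun p => H q p

/-- linear version of `TT` -/
def TTl (φ : P →ₗ[(Module.End A Q)ᵐᵒᵖ] (Module.End A Q)ᵐᵒᵖ) :
    (Q →ₗ[k] k) →ₗ[k] Fm Q (Dunop k (Module.End A Q) P) where
  toFun ξ := TT k φ ξ
  map_add' ξ ξ' := fv_ext k fun q p => rfl
  map_smul' c ξ := fv_ext k fun q p => by
    rw [RingHom.id_apply, fv_k, fv_TT, fv_TT]; rfl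

variable [Module.Finite k Q]

theorem sepQ {x y : Q} (h : ∀ φ : Q →ₗ[k] k, φ x = φ y) : x = y := by
  rw [← sub_eq_zero]
  refine (Module.forall_dual_apply_eq_zero_iff k _).1 fun φ => ?_
  rw [map_sub, h, sub_self]

/-- underlying function of `Psi` -/
def psiFun (φ : P →ₗ[(Module.End A Q)ᵐᵒᵖ] (Module.End A Q)ᵐᵒᵖ)
    (x : Gm k (Dunop k (Module.End A Q) P)) : Q :=
  (Module.evalEquiv k Q).symm
    ((show Fm Q (Dunop k (Module.End A Q) P) →ₗ[k] k from x) ∘ₗ TTl k φ)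

theorem psiFun_spec (φ : P →ₗ[(Module.End A Q)ᵐᵒᵖ] (Module.End A Q)ᵐᵒᵖ)
    (x : Gm k (Dunop k (Module.End A Q) P)) (ξ : Q →ₗ[k] k) :
    ξ (psiFun k φ x) = (show Fm Q (Dunop k (Module.End A Q) P) →ₗ[k] k from x) (TT k φ ξ) := by
  unfold psiFun
  rw [Module.apply_evalEquiv_symm_apply]; rfl

/-- the inverse of `Phi` -/
def Psi (φ : P →ₗ[(Module.End A Q)ᵐᵒᵖ] (Module.End A Q)ᵐᵒᵖ) :
    Gm k (Dunop k (Module.End A Q) P) →ₗ[A] Q where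
  toFun x := psiFun k φ x
  map_add' x y := sepQ k fun ξ => by
    rw [map_add, psiFun_spec, psiFun_spec, psiFun_spec]; rfl
  map_smul' a x := sepQ k fun ξ => by
    rw [psiFun_spec, RingHom.id_apply]
    let ξ' : Q →ₗ[k] k := ξ ∘ₗ DistribSMul.toLinearMap k Q a
    change _ = ξ' (psiFun k φ x)
    rw [psiFun_spec]
    change (show Fm Q (Dunop k (Module.End A Q) P) →ₗ[k] k from x) (op a • TT k φ ξ) = _
    congr 1
    refine fv_ext k fun q p => ?_
    change ξ ((φ p).unop (a • q)) = ξ (a • (φ p).unop q)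
    rw [LinearMap.map_smul]

theorem Phi_Psi (φ : P →ₗ[(Module.End A Q)ᵐᵒᵖ] (Module.End A Q)ᵐᵒᵖ) : Phi k (Psi k φ) = φ := by
  refine LinearMap.ext fun p => ?_
  apply unop_injective
  refine LinearMap.ext fun q => ?_
  refine sepQ k fun ξ => ?_
  exact psiFun_spec k φ (ww k p q) ξ

/-- dual basis argument -/
theorem exists_dual_basis {R : Type} [Ring R] (P : Type) [AddCommGroup P] [Module R P]
    [Module.Finite R P] [Module.Projective R P] :
    ∃ (r : ℕ) (p : Fin r → P) (φ : Fin r → (P →ₗ[R] R)), ∀ x, ∑ i, φ i x • p i = x := by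
  obtain ⟨r, f, g, h1, h2, h3⟩ := Module.Finite.exists_comp_eq_id_of_projective R P
  refine ⟨r, fun i => f (Pi.single i 1), fun i => LinearMap.proj i ∘ₗ g, fun x => ?_⟩
  have : ∀ y : Fin r → R, ∑ i, y i • f (Pi.single i 1) = f y := by
    intro y
    simp_rw [← map_smul, ← map_sum]
    congr 1
    ext j
    simp [Finset.sum_apply, Pi.single_apply]
  exact (this (g x)).trans (congrArg (fun u => u x) h3)

variable [Module.Finite (Module.End A Q)ᵐᵒᵖ P] [Module.Projective (Module.End A Q)ᵐᵒᵖ P]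

theorem gm_dual_basis : ∃ (r : ℕ) (p : Fin r → P)
    (φ : Fin r → (P →ₗ[(Module.End A Q)ᵐᵒᵖ] (Module.End A Q)ᵐᵒᵖ)),
    ∀ x : Gm k (Dunop k (Module.End A Q) P), ∑ i, ww k (p i) (Psi k (φ i) x) = x := by
  obtain ⟨r, p, φ, h⟩ := exists_dual_basis (R := (Module.End A Q)ᵐᵒᵖ) P
  refine ⟨r, p, φ, fun x => gm_ext k fun g => ?_⟩
  let ev : Gm k (Dunop k (Module.End A Q) P) →+ k :=
    { toFun := fun x => (show Fm Q (Dunop k (Module.End A Q) P) →ₗ[k] k from x) g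
      map_zero' := rfl
      map_add' := fun _ _ => rfl }
  change ev _ = (show Fm Q (Dunop k (Module.End A Q) P) →ₗ[k] k from x) g
  rw [map_sum]
  let ξ : Fin r → (Q →ₗ[k] k) := fun i =>
    { toFun := fun q => fv k g q (p i)
      map_add' := fun q q' => congrArg (fun u : P →ₗ[k] k => u (p i)) (map_add (fmFn g) q q')
      map_smul' := fun c q => by
        have h := (fmFn g).map_smul (algebraMap k (Module.End A Q) c) q
        have h2 := h.trans (Dunop_smul k P c (fmFn g q))
        exact congrArg (fun u : P →ₗ[k] k => u (p i)) h2 }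
  have h1 : ∀ i, ev (ww k (p i) (Psi k (φ i) x)) =
      (show Fm Q (Dunop k (Module.End A Q) P) →ₗ[k] k from x) (TT k (φ i) (ξ i)) := by
    intro i
    exact psiFun_spec k (φ i) x (ξ i)
  rw [Finset.sum_congr rfl fun i _ => h1 i]
  refine (map_sum (show Fm Q (Dunop k (Module.End A Q) P) →ₗ[k] k from x) _ _).symm.trans ?_
  refine congrArg (show Fm Q (Dunop k (Module.End A Q) P) →ₗ[k] k from x) ?_
  refine fv_ext k fun q p' => ?_
  let ev2 : Fm Q (Dunop k (Module.End A Q) P) →+ k :=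
    { toFun := fun g => fv k g q p'
      map_zero' := rfl
      map_add' := fun _ _ => rfl }
  change ev2 _ = _
  rw [map_sum]
  have h2 : ∀ i, ev2 (TT k (φ i) (ξ i)) = fv k g q ((φ i p') • p i) := by
    intro i
    exact fv_e k g (φ i p').unop q (p i)
  simp_rw [h2]
  conv_rhs => rw [← h p']
  exact (map_sum (show P →ₗ[k] k from fmFn g q) _ _).symm

theorem gm_inAdd : InAdd A Q (Gm k (Dunop k (Module.End A Q) P)) := by
  obtain ⟨r, p, φ, h⟩ := gm_dual_basis k (P := P)
  exact inAdd_iff.2 ⟨r, fun i => Psi k (φ i), fun i => ww k (p i), h⟩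

theorem Phi_inj : Function.Injective
    (Phi k : (Gm k (Dunop k (Module.End A Q) P) →ₗ[A] Q) → _) := by
  intro u v huv
  obtain ⟨r, p, φ, h⟩ := gm_dual_basis k (P := P)
  have h1 : ∀ p, u ∘ₗ ww k p = v ∘ₗ ww k p := fun p =>
    op_injective (congrArg (fun f => f p) huv)
  refine LinearMap.ext fun x => ?_
  rw [← h x, map_sum, map_sum]
  exact Finset.sum_congr rfl fun i _ => congrArg (fun f => f (Psi k (φ i) x)) (h1 (p i))

end Psi
end Paper
end Part7

noncomputable section Part8
namespace Paper
open MulOpposite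

section Final
variable (k : Type) [Field k] {A : Type} [Ring A] [Algebra k A] {Q : ModuleCat.{0} A}
variable [FiniteDimensional k A] [Module.Finite A Q]

theorem fdop (B : Type) [Ring B] [Algebra k B] [FiniteDimensional k B] :
    FiniteDimensional k Bᵐᵒᵖ := Module.Finite.equiv (opLinearEquiv k)

theorem fin_of_superfluous {R : Type} [Ring R] {P M : ModuleCat.{0} R} (f : P →ₗ[R] M)
    [Module.Finite R (LinearMap.range f)] (hs : Superfluous R (LinearMap.ker f)) :
    Module.Finite R P := by
  obtain ⟨r, v, hv⟩ := Module.Finite.exists_fin (R := R) (M := LinearMap.range f)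
  choose p hp using fun i => (v i).2
  have h1 : Submodule.span R (Set.range p) ⊔ LinearMap.ker f = ⊤ := by
    rw [eq_top_iff]
    intro x _
    have h2 : (⟨f x, ⟨x, rfl⟩⟩ : LinearMap.range f) ∈ Submodule.span R (Set.range v) := by
      rw [hv]; trivial
    have h3 : f x ∈ (Submodule.span R (Set.range p)).map f := by
      rw [Submodule.map_span, ← Set.range_comp]
      have h4 := Submodule.mem_map_of_mem (f := (LinearMap.range f).subtype) h2
      rw [Submodule.map_span, ← Set.range_comp] at h4
      have hc : (⇑f ∘ p) = ((LinearMap.range f).subtype ∘ v) := funext hp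
      rw [hc]; exact h4
    obtain ⟨y, hy, hyx⟩ := h3
    rw [Submodule.mem_sup]
    refine ⟨y, hy, x - y, ?_, by abel⟩
    rw [LinearMap.mem_ker, map_sub, hyx, sub_self]
  have h5 := hs _ h1
  exact ⟨by rw [← h5]; exact Submodule.fg_span (Set.finite_range p)⟩

theorem envelope {Z I : ModuleCat.{0} (Module.End A Q)} [Module.Finite (Module.End A Q) Z]
    (ι : Z →ₗ[Module.End A Q] I) (hι : IsInjEnvelope (Module.End A Q) ι) :
    Module.Finite (Module.End A Q) I ∧ InAdd A Q (Gm k I) := by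
  obtain ⟨hI, h1, h2⟩ := hι
  have := fdQ k (Q := Q)
  have := fdE k (Q := Q)
  have := fdop k (Module.End A Q)
  have : IsNoetherianRing (Module.End A Q)ᵐᵒᵖ := IsNoetherianRing.of_finite k _
  have : IsNoetherianRing (Module.End A Q) := IsNoetherianRing.of_finite k _
  have := fin_k k Z
  have := Dop_fin k Z
  have := fin_B k (Dop k (Module.End A Q) Z)
  obtain ⟨e⟩ := bidual k Z
  obtain ⟨F, K, i, p, f1, f2, f3, f4, f5, f6⟩ := exists_pres (Dop k (Module.End A Q) Z)
  have := fin_k k F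
  have := Dunop_fin k F
  have := fin_B k (Dunop k (Module.End A Q) F)
  have hinj := inj_dual k F
  let j : Z →ₗ[Module.End A Q] Dunop k (Module.End A Q) F := dualU k p ∘ₗ e.toLinearMap
  have hj : Function.Injective j := (dualU_inj k p f6).comp e.injective
  obtain ⟨h, hh⟩ := hinj.out ι h1 j
  have hker : LinearMap.ker h = ⊥ := by
    refine h2 _ ?_
    rw [eq_bot_iff]
    rintro _ ⟨hx, z, rfl⟩
    have : j z = 0 := (hh z).symm.trans hx
    have hz : z = 0 := hj (this.trans (map_zero j).symm)
    rw [hz, map_zero]; exact Submodule.zero_mem _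
  have hh' : Function.Injective h := LinearMap.ker_eq_bot.1 hker
  refine ⟨Module.Finite.of_injective h hh', ?_⟩
  obtain ⟨t, ht⟩ := hI.out h hh' (LinearMap.id)
  have ht' : t ∘ₗ h = LinearMap.id := LinearMap.ext ht
  refine InAdd.retract (gm_inAdd k (P := F)) (gmap k t) (gmap k h) fun x => ?_
  have h3 := gmap_comp k h t
  rw [ht'] at h3
  exact (congrArg (fun u => u x) h3).symm

/-- the invariant kept along the cosyzygies -/
def Inv (n m l i : ℕ) (Z : ModuleCat.{0} (Module.End A Q)) : Prop :=
  Module.Finite (Module.End A Q) Z ∧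
  (∀ j, 1 ≤ j → j + i + 2 ≤ n → EV (Module.End A Q) Q Z j) ∧
  (∀ j, 1 ≤ j → m < j + i → EV A (Gm k Z) Q j) ∧
  (∀ (N : Type) [AddCommGroup N] [Module A N] [Module.Finite A N] (j : ℕ), l < j → n < j + i →
    EV A (Gm k Z) N j)

/-- `Gm` of an isomorphism -/
def gmEquiv {Z Z' : ModuleCat.{0} (Module.End A Q)} (e : Z ≃ₗ[Module.End A Q] Z') :
    Gm k Z' ≃ₗ[A] Gm k Z :=
  LinearEquiv.ofLinearMap (gmap k e.toLinearMap) (gmap k e.symm.toLinearMap)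
    (by rw [← gmap_comp, ← gmap_id]; congr 1; ext x; simp)
    (by rw [← gmap_comp, ← gmap_id]; congr 1; ext x; simp)

theorem Inv.iso {n m l i : ℕ} {Z Z' : ModuleCat.{0} (Module.End A Q)} (h : Inv k n m l i Z)
    (e : Z ≃ₗ[Module.End A Q] Z') : Inv k n m l i Z' := by
  obtain ⟨h0, h1, h2, h3⟩ := h
  exact ⟨Module.Finite.equiv e, fun j a b => (h1 j a b).congr_right e,
    fun j a b => (h2 j a b).congr_left (gmEquiv k e).symm,
    fun N _ _ _ j a b => (h3 N j a b).congr_left (gmEquiv k e).symm⟩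

theorem Inv.step {n m l i : ℕ} {Z Z' : ModuleCat.{0} (Module.End A Q)} (h : Inv k n m l i Z)
    (hso : SelfOrth A Q) (hpd : pdLE A Q l)
    (hZ : IsCosyzygyOf (Module.End A Q) Z Z') (hi : i + 3 ≤ n) : Inv k n m l (i+1) Z' := by
  obtain ⟨h0, h1, h2, h3⟩ := h
  obtain ⟨I, ι, hι, ⟨e⟩⟩ := hZ
  obtain ⟨hI, hG⟩ := envelope k ι hι
  obtain ⟨hinj, hι1, -⟩ := hι
  let p : I →ₗ[Module.End A Q] Z' := e.symm.toLinearMap ∘ₗ (LinearMap.range ι).mkQ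
  have hp : Function.Surjective p := e.symm.surjective.comp (Submodule.mkQ_surjective _)
  have hx : Function.Exact ι p := by
    intro y
    rw [← exact_mkQ ι y]
    exact e.symm.map_eq_zero_iff
  have g1 : Function.Injective (gmap k p) := gmap_inj k p fun g =>
    lift_of_ev ι p hι1 hx hp (h1 1 le_rfl (by omega)) g
  have g2 := gmap_exact k ι p hι1 hx
  have g3 := gmap_surj k ι hι1
  refine ⟨Module.Finite.of_surjective p hp, ?_, ?_, ?_⟩
  · intro j a b
    exact ev_cquot ι p hι1 hx hp (ev_inj a) (h1 (j+1) (by omega) (by omega))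
  · intro j a b
    exact ev_sub _ _ g1 g2 g3 ((ev_of_selfOrth hso a).inAdd hG) (h2 (j+1) (by omega) (by omega))
  · intro N _ _ _ j a b
    exact ev_sub _ _ g1 g2 g3 ((ev_of_pdLE hpd N j a).inAdd hG) (h3 N (j+1) (by omega) (by omega))

theorem Inv.omega {n m l : ℕ} (hso : SelfOrth A Q) (hpd : pdLE A Q l) (t : ℕ) :
    ∀ {i : ℕ} {Z Z' : ModuleCat.{0} (Module.End A Q)}, Inv k n m l i Z →
    IsOmegaInvOf (Module.End A Q) t Z Z' → i + t + 2 ≤ n → Inv k n m l (i+t) Z' := by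
  induction t with
  | zero =>
    rintro i Z Z' h ⟨e⟩ -
    exact h.iso k e.symm
  | succ t ih =>
    rintro i Z Z' h ⟨Y, hY, hZ⟩ hi
    have := ih (h.step k hso hpd hY (by omega)) hZ (by omega)
    rwa [show i + 1 + t = i + (t + 1) by omega] at this

theorem Inv.base {n m l : ℕ} (hpair : IsRelAGPair A Q n) (hid : idLE A Q m) (hn : 2 ≤ n) :
    Inv k n m l 0 (QE Q) := by
  obtain ⟨p1, p2, p3, p4⟩ := hpair
  have hA1 : Cogen Q A := domdim_cogen (X := ModuleCat.of A A) (n := n - 1)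
    (by rwa [Nat.sub_add_cancel (by omega)])
  have hA2 : EvSurj Q A := domdim_evSurj (X := ModuleCat.of A A) (n := n - 2)
    (by rwa [Nat.sub_add_cancel (by omega)])
  refine ⟨finEQ k, ?_, ?_, ?_⟩
  · intro j a b
    obtain ⟨j, rfl⟩ : ∃ i, j = i + 1 := ⟨j - 1, by omega⟩
    have := domdim_ev (Q := Q) (X := ModuleCat.of A A) j (n := n - j - 3)
      (by rwa [show n - j - 3 + j + 3 = n by omega])
    exact this.congr_left (LinearMap.ringLmapEquivSelf A (Module.End A Q) Q)
  · intro j a b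
    exact ev_of_idLE hid _ j (by omega)
  · intro N _ _ _ j a b
    obtain ⟨j, rfl⟩ : ∃ i, j = i + 1 := ⟨j - 1, by omega⟩
    obtain ⟨N', hN'⟩ : ∃ N' : ModuleCat.{0} A, N' = ModuleCat.of A N := ⟨_, rfl⟩
    have hf : Module.Finite A N' := by rw [hN']; infer_instance
    suffices h : EV A (Gm k (QE Q)) N' (j+1) by subst hN'; exact h
    have := fin_k k N'
    have := fdop k A
    have := Dop_fin k N'
    obtain ⟨e2⟩ := bidual k N'
    obtain ⟨AA, p2, hfin, ⟨e⟩⟩ : ∃ AA : ModuleCat.{0} Aᵐᵒᵖ, idLE Aᵐᵒᵖ AA n ∧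
        Module.Finite Aᵐᵒᵖ AA ∧ Nonempty (AA ≃ₗ[Aᵐᵒᵖ] Fm Q (QE Q)) :=
      ⟨ModuleCat.of Aᵐᵒᵖ Aᵐᵒᵖ, p2, (inferInstance : Module.Finite Aᵐᵒᵖ Aᵐᵒᵖ), fm_QE hA1 hA2⟩
    have := fin_k k AA
    have h1 : EV Aᵐᵒᵖ (Dop k A N') AA (j+1) := ev_of_idLE p2 _ _ (by omega)
    exact ((ev_dual k j h1).congr_right e2.symm).congr_left (dualU_equiv k e).symm

end Final
end Paper
end Part8

noncomputable section Part9
namespace Paper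
open MulOpposite

theorem coreA {A : Type} [Ring A] [IsNoetherianRing A] {Q : ModuleCat.{0} A} [Module.Finite A Q]
    (hA1 : Cogen Q A) (hA2 : EvSurj Q A) (hso : SelfOrth A Q) (l : ℕ) (hpd : pdLE A Q l)
    {X1 X0 G : ModuleCat.{0} A} (x : X1 →ₗ[A] X0) (v : X0 →ₗ[A] G)
    (hxv : Function.Exact x v) (hv : Function.Surjective v)
    (h1 : InAdd A Q X1) (h0 : InAdd A Q X0)
    (hGQ : ∀ j, 1 ≤ j → EV A G Q j)
    (hGN : ∀ (N : Type) [AddCommGroup N] [Module A N] [Module.Finite A N] (j : ℕ), l + 2 < j →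
      EV A G N j)
    (T : ModuleCat.{0} (Module.End A Q)) (α : (X1 →ₗ[A] Q) →ₗ[Module.End A Q] T)
    (hα : Function.Surjective α) (hα' : ∀ h, α h = 0 ↔ ∃ h', h' ∘ₗ x = h) :
    CoresLE (Module.End A Q) (ModuleCat.of _ Q) (InAdd (Module.End A Q) (ModuleCat.of _ Q)) T l := by
  have hfX1 : Module.Finite A X1 := h1.finite
  have hC : Function.Exact (LinearMap.range x).subtype v := by
    intro y
    rw [hxv y]
    constructor
    · rintro ⟨z, rfl⟩; exact ⟨⟨x z, z, rfl⟩, rfl⟩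
    · rintro ⟨⟨_, z, rfl⟩, rfl⟩; exact ⟨z, rfl⟩
  have hCi : Function.Injective (LinearMap.range x).subtype := Submodule.injective_subtype _
  have hLi : Function.Injective (LinearMap.ker x).subtype := Submodule.injective_subtype _
  have hL : Function.Exact (LinearMap.ker x).subtype x.rangeRestrict := by
    intro y
    rw [← exact_ker x y]
    exact ⟨fun h => congrArg Subtype.val h, fun h => Subtype.ext h⟩
  have hLs : Function.Surjective x.rangeRestrict := x.surjective_rangeRestrict
  have cQ : ∀ j, 1 ≤ j → EV A (LinearMap.range x) Q j := fun j hj =>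
    ev_sub _ _ hCi hC hv ((ev_of_selfOrth hso hj).inAdd h0) (hGQ (j+1) (by omega))
  have lQ : ∀ j, 1 ≤ j → EV A (LinearMap.ker x) Q j := fun j hj =>
    ev_sub _ _ hLi hL hLs ((ev_of_selfOrth hso hj).inAdd h1) (cQ (j+1) (by omega))
  have cN : ∀ (N : Type) [AddCommGroup N] [Module A N] [Module.Finite A N] (j : ℕ), l + 1 < j →
      EV A (LinearMap.range x) N j := fun N _ _ _ j hj =>
    ev_sub _ _ hCi hC hv ((ev_of_pdLE hpd N j (by omega)).inAdd h0) (hGN N (j+1) (by omega))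
  have lN : ∀ (N : Type) [AddCommGroup N] [Module A N] [Module.Finite A N] (j : ℕ), l < j →
      EV A (LinearMap.ker x) N j := fun N _ _ _ j hj =>
    ev_sub _ _ hLi hL hLs ((ev_of_pdLE hpd N j hj).inAdd h1) (cN N (j+1) (by omega))
  have hext := extend_of_ev _ _ hLi hL hLs (cQ 1 le_rfl)
  have hco : Cogen Q (LinearMap.ker x) := Cogen.of_inj (cogen_self.inAdd h1) _ hLi
  have hes : EvSurj Q (LinearMap.ker x) :=
    EvSurj.ker _ x (exact_ker x) (evSurj_self.inAdd h1) (cogen_self.inAdd h0) hext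
  have := final_cores hA1 hA2 l (LinearMap.ker x) lN lQ hco hes
  refine this.congr ?_
  have hk : LinearMap.ker α = LinearMap.ker (hmap Q (LinearMap.ker x).subtype) := by
    ext h
    rw [LinearMap.mem_ker, LinearMap.mem_ker, hα']
    constructor
    · rintro ⟨h', rfl⟩
      refine LinearMap.ext fun y => ?_
      change h' (x y.1) = 0
      rw [LinearMap.mem_ker.1 y.2, map_zero]
    · intro hh
      obtain ⟨w, hw⟩ := exists_factor _ _ hL hLs h hh
      obtain ⟨w', hw'⟩ := extend_of_ev _ _ hCi hC hv (hGQ 1 le_rfl) w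
      refine ⟨w', ?_⟩
      rw [← hw, ← hw']; rfl
  exact (α.quotKerEquivOfSurjective hα).symm.trans
    ((Submodule.quotEquivOfEq _ _ hk).trans
      ((hmap Q (LinearMap.ker x).subtype).quotKerEquivOfSurjective hext))

section
variable (k : Type) [Field k] {A : Type} [Ring A] [Algebra k A] {Q : ModuleCat.{0} A}
variable [FiniteDimensional k A] [Module.Finite A Q]

/-- the comparison map onto the transpose -/
def alph {P1 P0 : ModuleCat.{0} (Module.End A Q)ᵐᵒᵖ} (g : P1 →ₗ[(Module.End A Q)ᵐᵒᵖ] P0)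
    {Tr2 : ModuleCat.{0} (Module.End A Q)ᵐᵒᵖᵐᵒᵖ} {T : ModuleCat.{0} (Module.End A Q)}
    (e1 : T ≃ₗ[Module.End A Q] (ModuleCat.restrictScalars (opOpHom (Module.End A Q))).obj Tr2)
    (e2 : Tr2 ≃ₗ[(Module.End A Q)ᵐᵒᵖᵐᵒᵖ] ((P1 →ₗ[(Module.End A Q)ᵐᵒᵖ] (Module.End A Q)ᵐᵒᵖ) ⧸
      LinearMap.range (lprecomp (Module.End A Q)ᵐᵒᵖ g))) :
    (Gm k (Dunop k (Module.End A Q) P1) →ₗ[A] Q) →ₗ[Module.End A Q] T where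
  toFun h := e1.symm (e2.symm ((LinearMap.range (lprecomp (Module.End A Q)ᵐᵒᵖ g)).mkQ (Phi k h)))
  map_add' h h' := by
    rw [Phi_add, map_add, map_add]; exact map_add e1.symm _ _
  map_smul' e h := by
    rw [Phi_smul, map_smul, map_smul]; exact map_smul e1.symm e _

theorem main_aux (n m l : ℕ)
    (hpair : IsRelAGPair A Q n) (hpd : pdLE A Q l) (hid : idLE A Q m)
    (hn : m + l + 2 ≤ n) (T : ModuleCat.{0} (Module.End A Q))
    (hT : IsTauInvN k (Module.End A Q) (n - l - 1) (ModuleCat.of (Module.End A Q) Q) T) :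
    CoresLE (Module.End A Q) (ModuleCat.of _ Q) (InAdd (Module.End A Q) (ModuleCat.of _ Q)) T l := by
  obtain ⟨Z, hZ, Tr2, ⟨P1, P0, g, p, hp, hP1, hgp, hsg, ⟨e2⟩⟩, ⟨e1⟩⟩ := hT
  have hso : SelfOrth A Q := hpair.2.2.1
  have hI : Inv k n m l (0 + (n - l - 1 - 1)) Z :=
    Inv.omega k hso hpd _ (Inv.base k hpair hid (by omega)) hZ (by omega)
  obtain ⟨hZf, -, hI2, hI3⟩ := hI
  obtain ⟨hP0, hps, hpk⟩ := hp
  have hdd := hpair.2.2.2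
  have hA1 : Cogen Q A := domdim_cogen (X := ModuleCat.of A A) (n := n - 1)
    (by rwa [Nat.sub_add_cancel (by omega)])
  have hA2 : EvSurj Q A := domdim_evSurj (X := ModuleCat.of A A) (n := n - 2)
    (by rwa [Nat.sub_add_cancel (by omega)])
  have := fdQ k (Q := Q)
  have := fdE k (Q := Q)
  have := fdop k (Module.End A Q)
  have : IsNoetherianRing A := IsNoetherianRing.of_finite k _
  have : IsNoetherianRing (Module.End A Q)ᵐᵒᵖ := IsNoetherianRing.of_finite k _
  have := fin_k k Z
  have := Dop_fin k Z
  have := fin_B k (Dop k (Module.End A Q) Z)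
  have hP0f : Module.Finite (Module.End A Q)ᵐᵒᵖ P0 := fin_of_superfluous p hpk
  have hP1f : Module.Finite (Module.End A Q)ᵐᵒᵖ P1 := fin_of_superfluous g hsg
  obtain ⟨e⟩ := bidual k Z
  have hj : Function.Injective (dualU k p ∘ₗ e.toLinearMap) :=
    (dualU_inj k p hps).comp e.injective
  have hjx : Function.Exact (dualU k p ∘ₗ e.toLinearMap) (dualU k g) := by
    intro y
    rw [dualU_exact k g p hgp y]
    constructor
    · rintro ⟨z, rfl⟩; exact ⟨e.symm z, congrArg (dualU k p) (e.apply_symm_apply z)⟩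
    · rintro ⟨z, rfl⟩; exact ⟨e z, rfl⟩
  refine coreA hA1 hA2 hso l hpd (gmap k (dualU k g)) (gmap k (dualU k p ∘ₗ e.toLinearMap))
    (gmap_exact k _ _ hj hjx) (gmap_surj k _ hj) (gm_inAdd k) (gm_inAdd k)
    (fun j hj => hI2 j hj (by omega)) (fun N _ _ _ j hj => hI3 N j (by omega) (by omega))
    T (alph k g e1 e2) ?_ ?_
  · intro t
    obtain ⟨φ, hφ⟩ := Submodule.mkQ_surjective _ (e2 (e1 t))
    refine ⟨Psi k φ, ?_⟩
    change e1.symm (e2.symm (Submodule.mkQ _ (Phi k (Psi k φ)))) = t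
    rw [Phi_Psi, hφ]
    exact (congrArg e1.symm (e2.symm_apply_apply (e1 t))).trans (e1.symm_apply_apply t)
  · intro h
    have h1 : alph k g e1 e2 h = 0 ↔
        (LinearMap.range (lprecomp (Module.End A Q)ᵐᵒᵖ g)).mkQ (Phi k h) = 0 :=
      (e1.symm.map_eq_zero_iff).trans e2.symm.map_eq_zero_iff
    rw [h1, Submodule.mkQ_apply, Submodule.Quotient.mk_eq_zero]
    constructor
    · rintro ⟨φ, hφ⟩
      refine ⟨Psi k φ, Phi_inj k ?_⟩
      rw [Phi_nat, Phi_Psi]; exact hφ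
    · rintro ⟨h', rfl⟩
      exact ⟨Phi k h', rfl⟩
end
end Paper
end Part9

noncomputable section Statement7
open Paper

/-- Lemma 3.1: for a relative `n`-Auslander–Gorenstein pair `(A, Q)`
with `pd_A Q = l`, `id_A Q = m` and `n ≥ m + l + 2`, there is an exact sequence
`0 → τ⁻_{n−l−1}(Q) → Q_0 → ⋯ → Q_l → 0` of right `Λ`-modules (`Λ = End_A(Q)^op`,
i.e. left `End_A(Q)`-modules) with terms in `add Q` remaining exact under
`Hom_Λ(−, Q)`. -/
theorem stmt7 (k : Type) [Field k] (A : Type) [Ring A] [Algebra k A] [FiniteDimensional k A]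
    (Q : ModuleCat.{0} A) [Module.Finite A Q] (n m l : ℕ)
    (hpair : IsRelAGPair A Q n) (hpd : pdEq A Q l) (hid : idEq A Q m)
    (hn : m + l + 2 ≤ n) :
    ∀ T : ModuleCat.{0} (Module.End A Q),
      IsTauInvN k (Module.End A Q) (n - l - 1) (ModuleCat.of (Module.End A Q) Q) T →
      RelAddCodimLE (Module.End A Q) (ModuleCat.of (Module.End A Q) Q) T l := by
  intro T hT
  exact main_aux k n m l hpair hpd.1 hid.1 hn T hT

end Statement7
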